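/- Let i and j be real numbers with 0 < i, j < 1 and i + j = 1, set σ := min{i, j}, and let θ ∈ ℝ². Let a, b ∈ ℝ with a ≠ 0, and let L_{a,b} := {(x, ax + b) : x ∈ ℝ}. Suppose there exists ε > 0 such that liminf_{q→∞} q^{1/σ − ε} · max{‖qa‖, ‖qb‖} > 0, where the liminf is over positive integers q. Then the Hausdorff dimension of Bad_θ(i,j) ∩ L_{a,b} equals 1. -/

import Mathlib

open Filter Set

/-- Distance from a real number to the nearest integer. -/
noncomputable def distNearestInt (t : ℝ) : ℝ := |t - round t|

/-- The inhomogeneous set `Bad_θ(i,j)` of `(i,j)`-badly approximable pairs. -/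
def badPair (i j : ℝ) (θ : ℝ × ℝ) : Set (ℝ × ℝ) :=
  {p : ℝ × ℝ | ∃ c : ℝ, 0 < c ∧ ∀ q : ℕ, 0 < q →
    c / (q : ℝ) < max (distNearestInt ((q : ℝ) * p.1 - θ.1) ^ (1 / i))
                      (distNearestInt ((q : ℝ) * p.2 - θ.2) ^ (1 / j))}

/-- Selecting `m` even good children out of `4 m`. -/
lemma exists_children (m : ℕ) (Q : ℕ → Prop) (h : {k | k < 4 * m ∧ ¬ Q k}.ncard ≤ m) :
    ∃ d : Fin m → ℕ, Function.Injective d ∧ ∀ i, d i < 4 * m ∧ Even (d i) ∧ Q (d i) := by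
  classical
  set E : Finset ℕ := (Finset.range (2 * m)).image (fun k => 2 * k) with hE
  have hEc : E.card = 2 * m := by
    rw [hE, Finset.card_image_of_injective _ (fun a b hab => by simpa using hab)]; simp
  set B : Finset ℕ := (Finset.range (4 * m)).filter (fun k => ¬ Q k) with hB
  have hBc : B.card ≤ m := by
    have : {k | k < 4 * m ∧ ¬ Q k} = (B : Set ℕ) := by ext k; simp [hB]
    rw [this, Set.ncard_coe_finset] at h
    exact h
  have hcard : m ≤ (E \ B).card := by
    have := Finset.le_card_sdiff B E
    omega
  obtain ⟨t, ht, htc⟩ := Finset.exists_subset_card_eq hcard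
  refine ⟨fun i => t.orderEmbOfFin htc i, (t.orderEmbOfFin htc).injective, fun i => ?_⟩
  have hmem := ht (t.orderEmbOfFin_mem htc i)
  rw [Finset.mem_sdiff] at hmem
  obtain ⟨h1, h2⟩ := hmem
  obtain ⟨k, hk, hk2⟩ := Finset.mem_image.1 h1
  rw [Finset.mem_range] at hk
  have hlt : t.orderEmbOfFin htc i < 4 * m := by rw [← hk2]; omega
  refine ⟨hlt, ⟨k, by simp only [← hk2]; ring⟩, ?_⟩
  by_contra hQ
  exact h2 (Finset.mem_filter.2 ⟨Finset.mem_range.2 hlt, hQ⟩)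

/-- The nodes of the Cantor tree. -/
noncomputable def cantorNode {m : ℕ} (d : ℕ → ℝ → Fin m → ℕ) (x0 : ℝ) (ω : ℕ → Fin m) : ℕ → ℝ
  | 0 => x0
  | n + 1 => cantorNode d x0 ω n + (d n (cantorNode d x0 ω n) (ω n) : ℝ) / ((4 * m : ℕ) : ℝ) ^ (n + 1)

lemma cantorNode_congr {m : ℕ} (d : ℕ → ℝ → Fin m → ℕ) (x0 : ℝ) (ω ω' : ℕ → Fin m) (n : ℕ)
    (h : ∀ k < n, ω k = ω' k) : cantorNode d x0 ω n = cantorNode d x0 ω' n := by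
  induction n with
  | zero => rfl
  | succ n ih =>
    have := ih (fun k hk => h k (by omega))
    simp only [cantorNode]
    rw [this, h n (by omega)]

theorem cantor_dim (m : ℕ) (hm : 2 ≤ m) (P : ℕ → ℝ → Prop) (x0 : ℝ) (h0 : P 0 x0)
    (hstep : ∀ n x, P n x →
      {k : ℕ | k < 4 * m ∧ ¬ P (n + 1) (x + (k : ℝ) / ((4 * m : ℕ) : ℝ) ^ (n + 1))}.ncard ≤ m) :
    ENNReal.ofReal (Real.log m / Real.log ((4 * m : ℕ) : ℝ)) ≤
      dimH {y : ℝ | ∀ n, ∃ x, P n x ∧ x ≤ y ∧ y ≤ x + 1 / ((4 * m : ℕ) : ℝ) ^ n} := by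
  classical
  have hch : ∀ n x, ∃ d : Fin m → ℕ, Function.Injective d ∧ ∀ i, d i < 4 * m ∧ Even (d i) ∧
      (P n x → P (n + 1) (x + (d i : ℝ) / ((4 * m : ℕ) : ℝ) ^ (n + 1))) := by
    intro n x
    by_cases hP : P n x
    · obtain ⟨d, hd, hd2⟩ := exists_children m
        (fun k => P (n + 1) (x + (k : ℝ) / ((4 * m : ℕ) : ℝ) ^ (n + 1))) (hstep n x hP)
      exact ⟨d, hd, fun i => ⟨(hd2 i).1, (hd2 i).2.1, fun _ => (hd2 i).2.2⟩⟩
    · obtain ⟨d, hd, hd2⟩ := exists_children m (fun k => True) (by simp)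
      exact ⟨d, hd, fun i => ⟨(hd2 i).1, (hd2 i).2.1, fun h => absurd h hP⟩⟩
  choose d hinj hd using hch
  set R : ℝ := ((4 * m : ℕ) : ℝ) with hR
  have hR8 : (8 : ℝ) ≤ R := by rw [hR]; exact_mod_cast (by omega : 8 ≤ 4 * m)
  have hRpos : 0 < R := by linarith
  set X := cantorNode d x0 with hX
  have hXs : ∀ ω n, X ω (n + 1) = X ω n + (d n (X ω n) (ω n) : ℝ) / R ^ (n + 1) := fun ω n => rfl
  have hXP : ∀ ω n, P n (X ω n) := by
    intro ω n
    induction n with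
    | zero => exact h0
    | succ n ih => exact (hd n (X ω n) (ω n)).2.2 ih
  have hmono : ∀ ω, Monotone (X ω) := by
    intro ω
    refine monotone_nat_of_le_succ fun n => ?_
    rw [hXs]
    have : 0 ≤ (d n (X ω n) (ω n) : ℝ) / R ^ (n + 1) := by positivity
    linarith
  have hanti : ∀ ω, Antitone (fun n => X ω n + 1 / R ^ n) := by
    intro ω
    refine antitone_nat_of_succ_le fun n => ?_
    rw [hXs]
    have h1 : (d n (X ω n) (ω n) : ℝ) + 1 ≤ R := by
      rw [hR]; exact_mod_cast (hd n (X ω n) (ω n)).1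
    have h2 : 1 / R ^ n = R / R ^ (n + 1) := by
      rw [pow_succ]; field_simp
    rw [h2, add_assoc, ← add_div]
    gcongr
  have hle : ∀ ω n k, X ω n ≤ X ω k + 1 / R ^ k := by
    intro ω n k
    have h1 := hmono ω (le_max_left n k)
    have h2 := hanti ω (le_max_right n k)
    simp only at h2
    have h3 : 0 ≤ 1 / R ^ (max n k) := by positivity
    linarith
  set L : (ℕ → Fin m) → ℝ := fun ω => ⨆ n, X ω n with hL
  have hL1 : ∀ ω n, X ω n ≤ L ω := fun ω n =>
    le_ciSup (f := X ω) ⟨X ω 0 + 1 / R ^ 0, by rintro _ ⟨k, rfl⟩; exact hle ω k 0⟩ n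
  have hL2 : ∀ ω n, L ω ≤ X ω n + 1 / R ^ n := fun ω n => ciSup_le fun k => hle ω k n
  have hsub : range L ⊆ {y : ℝ | ∀ n, ∃ x, P n x ∧ x ≤ y ∧ y ≤ x + 1 / R ^ n} := by
    rintro _ ⟨ω, rfl⟩ n
    exact ⟨X ω n, hXP ω n, hL1 ω n, hL2 ω n⟩
  refine le_trans ?_ (dimH_mono hsub)
  -- separation
  have hsep : ∀ ω ω', ω ≠ ω' → ∃ n, (∀ k < n, ω k = ω' k) ∧ 1 / R ^ (n + 1) ≤ |L ω - L ω'| := by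
    intro ω ω' hne
    have hex : ∃ n, ω n ≠ ω' n := by
      by_contra hcon; push Not at hcon; exact hne (funext hcon)
    refine ⟨Nat.find hex, fun k hk => ?_, ?_⟩
    · have := Nat.find_min hex hk
      simpa using this
    set n := Nat.find hex with hn
    have hne' : ω n ≠ ω' n := Nat.find_spec hex
    have hxx : X ω n = X ω' n := cantorNode_congr d x0 ω ω' n (fun k hk => by
      have := Nat.find_min hex hk
      simpa using this)
    have a1 := hL1 ω (n + 1)
    have a2 := hL2 ω (n + 1)
    have b1 := hL1 ω' (n + 1)
    have b2 := hL2 ω' (n + 1)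
    rw [hXs] at a1 a2 b1 b2
    rw [← hxx] at b1 b2
    set u := d n (X ω n) (ω n) with hu
    set v := d n (X ω n) (ω' n) with hv
    have huv : u ≠ v := fun h => hne' (hinj n (X ω n) h)
    obtain ⟨u', hu'⟩ := (hd n (X ω n) (ω n)).2.1
    obtain ⟨v', hv'⟩ := (hd n (X ω n) (ω' n)).2.1
    rw [← hu] at hu'
    rw [← hv] at hv'
    set p := 1 / R ^ (n + 1) with hp
    have hppos : 0 < p := by positivity
    have eu : (u : ℝ) / R ^ (n + 1) = u * p := by rw [hp]; ring
    have ev : (v : ℝ) / R ^ (n + 1) = v * p := by rw [hp]; ring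
    rw [eu] at a1 a2
    rw [ev] at b1 b2
    rcases lt_or_gt_of_ne huv with h | h
    · have : (u : ℝ) + 2 ≤ v := by exact_mod_cast (by omega : u + 2 ≤ v)
      have : (u + 2 : ℝ) * p ≤ v * p := by gcongr
      rw [abs_sub_comm]
      refine le_trans ?_ (le_abs_self _)
      linarith
    · have : (v : ℝ) + 2 ≤ u := by exact_mod_cast (by omega : v + 2 ≤ u)
      have : (v + 2 : ℝ) * p ≤ u * p := by gcongr
      refine le_trans ?_ (le_abs_self _)
      linarith
  have hLinj : Function.Injective L := by
    intro ω ω' h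
    by_contra hne
    obtain ⟨n, -, h2⟩ := hsep ω ω' hne
    rw [h, sub_self, abs_zero] at h2
    have : 0 < 1 / R ^ (n + 1) := by positivity
    linarith
  have hmpos : (1 : ℝ) < m := by exact_mod_cast (by omega : 1 < m)
  have hlogm : 0 < Real.log m := Real.log_pos hmpos
  have hlogR : 0 < Real.log R := Real.log_pos (by linarith)
  set r : ℝ := Real.log m / Real.log R with hr
  have hrpos : 0 < r := div_pos hlogm hlogR
  have hRr : R ^ r = m := by
    rw [Real.rpow_def_of_pos hRpos, hr, mul_div_cancel₀ _ hlogR.ne', Real.exp_log (by linarith)]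
  have : Nonempty (ℕ → Fin m) := ⟨fun _ => ⟨0, by omega⟩⟩
  set f : ℝ → ℝ := fun y => Real.ofDigits (Function.invFun L y) with hf
  have hfL : ∀ ω, f (L ω) = Real.ofDigits ω := fun ω => by
    simp only [hf]; rw [Function.leftInverse_invFun hLinj]
  have hhold : HolderOnWith (m : NNReal) (Real.toNNReal r) f (range L) := by
    rintro _ ⟨ω, rfl⟩ _ ⟨ω', rfl⟩
    by_cases hne : ω = ω'
    · subst hne; simp
    obtain ⟨n, h1, h2⟩ := hsep ω ω' hne
    rw [hfL, hfL, edist_dist, edist_dist, Real.dist_eq, Real.dist_eq, Real.coe_toNNReal _ hrpos.le,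
      ENNReal.ofReal_rpow_of_nonneg (abs_nonneg _) hrpos.le]
    have hmm : ((m : NNReal) : ENNReal) = ENNReal.ofReal (m : ℝ) := by simp
    rw [hmm, ← ENNReal.ofReal_mul (by positivity)]
    apply ENNReal.ofReal_le_ofReal
    calc _ ≤ ((m : ℝ) ^ n)⁻¹ := Real.abs_ofDigits_sub_ofDigits_le h1
      _ = m * (1 / R ^ (n + 1)) ^ r := by
        rw [Real.div_rpow zero_le_one (by positivity), Real.one_rpow, ← Real.rpow_natCast R,
          ← Real.rpow_mul hRpos.le, mul_comm ((n + 1 : ℕ) : ℝ) r, Real.rpow_mul hRpos.le, hRr,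
          Real.rpow_natCast]
        field_simp
        ring
      _ ≤ _ := by gcongr
  have hd1 := hhold.dimH_image_le (by simpa using hrpos)
  have hsurj : Icc (0 : ℝ) 1 ⊆ Set.image f (range L) := by
    intro y hy
    obtain ⟨ω, -, hω⟩ := Real.ofDigits_SurjOn (by omega : 1 < m) hy
    exact ⟨L ω, ⟨ω, rfl⟩, by rw [hfL, hω]⟩
  have hd2 : (1 : ENNReal) ≤ dimH (Set.image f (range L)) := by
    refine le_trans ?_ (dimH_mono hsurj)
    have := Real.dimH_of_nonempty_interior (s := Icc (0 : ℝ) 1) (by simp)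
    rw [this]; simp
  have hd3 := hd2.trans hd1
  rw [ENNReal.le_div_iff_mul_le (by simp [hrpos]) (by simp), one_mul] at hd3
  exact hd3

lemma ncard_le_of_close (N : ℕ) (S : Set ℕ) (hS : ∀ k ∈ S, k < N) (D : ℝ)
    (h : ∀ k ∈ S, ∀ l ∈ S, |(k : ℝ) - l| ≤ D) : (S.ncard : ℝ) ≤ |D| + 1 := by
  classical
  rcases S.eq_empty_or_nonempty with rfl | hne
  · simp; positivity
  have hmem := Nat.sInf_mem hne
  set k0 := sInf S with hk0
  have hD : 0 ≤ D := (abs_nonneg _).trans (h k0 hmem k0 hmem)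
  have hsub : S ⊆ (Finset.Icc k0 (k0 + ⌊D⌋₊) : Finset ℕ) := by
    intro k hk
    have h1 : k0 ≤ k := Nat.sInf_le hk
    have h2 := (le_abs_self _).trans (h k hk k0 hmem)
    have h3 : k - k0 ≤ ⌊D⌋₊ := by
      apply Nat.le_floor
      rw [Nat.cast_sub h1]; exact h2
    simp only [Finset.coe_Icc, Set.mem_Icc]
    omega
  have h4 := Set.ncard_le_ncard hsub (Finset.finite_toSet _)
  rw [Set.ncard_coe_finset, Nat.card_Icc] at h4
  have h5 : S.ncard ≤ ⌊D⌋₊ + 1 := by omega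
  rw [abs_of_nonneg hD]
  calc (S.ncard : ℝ) ≤ (⌊D⌋₊ : ℝ) + 1 := by exact_mod_cast h5
    _ ≤ D + 1 := by have := Nat.floor_le hD; linarith

/-- No short primal vector at scale `(P, Q)` and point `x`. -/
def primOK (a b κ P Q x : ℝ) : Prop := ∀ p q r : ℤ, ¬ (p = 0 ∧ q = 0 ∧ r = 0) →
  κ ≤ |(q : ℝ)| / (P * Q) ∨ κ ≤ P * |q * x - p| ∨ κ ≤ Q * |a * p + b * q - r|

/-- No good inhomogeneous approximation at scale `(P, Q)` and point `x`. -/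
def inhOK (a b θ1 θ2 κ P Q s x : ℝ) : Prop := ∀ p q r : ℤ,
  κ * (P * Q) / s ≤ q → (q : ℝ) < κ * (P * Q) →
  2 * κ ≤ P * |q * x - p - θ1| ∨ 2 * κ ≤ Q * |a * p + b * q - r + (a * θ1 - θ2)|

lemma prim_one (a b κ P Q s1 s2 x y : ℝ) (hP : 0 < P) (hQ : 0 < Q) (hs1 : 2 < s1) (hs2 : 1 ≤ s2)
    (hκ : 0 < κ) (hprim : primOK a b κ P Q x) (p q r : ℤ) (hxy : |x - y| ≤ 1 / (P ^ 2 * Q))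
    (hne : ¬ (p = 0 ∧ q = 0 ∧ r = 0)) (h1 : |(q : ℝ)| / ((P * s1) * (Q * s2)) < κ)
    (h2 : (P * s1) * |q * y - p| < κ) (h3 : (Q * s2) * |a * p + b * q - r| < κ) :
    κ * (P * Q) / 2 ≤ |(q : ℝ)| ∧ P * |q * x - p| ≤ 2 * κ * (s1 * s2) ∧
    |(q : ℝ)| ≤ κ * (s1 * s2) * (P * Q) ∧ Q * |a * p + b * q - r| ≤ κ := by
  have hD : Q * |a * p + b * q - r| < κ := by
    refine lt_of_le_of_lt ?_ h3
    have : 0 ≤ Q * |a * p + b * q - r| := by positivity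
    nlinarith
  have hPQ : 0 < P * Q := by positivity
  have hE1 : |q * x - p| ≤ |q * y - p| + |(q : ℝ)| * (1 / (P ^ 2 * Q)) := by
    have : (q : ℝ) * x - p = (q * y - p) + q * (x - y) := by ring
    rw [this]
    refine (abs_add_le _ _).trans ?_
    rw [abs_mul (q : ℝ)]
    gcongr
  have hE2 : P * |q * x - p| ≤ P * |q * y - p| + |(q : ℝ)| / (P * Q) := by
    calc _ ≤ P * (|q * y - p| + |(q : ℝ)| * (1 / (P ^ 2 * Q))) := by gcongr
      _ = _ := by field_simp
  have hE3 : P * |q * y - p| ≤ κ / 2 := by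
    have h0 : 0 ≤ P * |q * y - p| := by positivity
    nlinarith
  have hq1 : |(q : ℝ)| / (P * Q) ≤ κ * (s1 * s2) := by
    rw [div_lt_iff₀ (by positivity)] at h1
    rw [div_le_iff₀ hPQ]
    nlinarith
  have hss : 1 ≤ s1 * s2 := by nlinarith
  have hq2 : κ / 2 ≤ |(q : ℝ)| / (P * Q) := by
    rcases hprim p q r hne with h | h | h
    · linarith
    · linarith
    · linarith
  refine ⟨?_, ?_, ?_, hD.le⟩
  · rw [le_div_iff₀ hPQ] at hq2; linarith
  · nlinarith
  · rwa [div_le_iff₀ hPQ] at hq1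

lemma prim_step (a b κ κd P Q s1 s2 x y z : ℝ) (hP : 0 < P) (hQ : 0 < Q)
    (hs1 : 2 < s1) (hs2 : 1 ≤ s2) (hκ : 0 < κ) (hc1 : 4 * κ ^ 2 * (s1 * s2) ^ 2 ≤ 1)
    (hc2 : 4 * κ ^ 2 * (s1 * s2) < κd)
    (hdual : ∀ A B C : ℤ, ¬ (A = 0 ∧ B = 0 ∧ C = 0) → |(B : ℝ)| ≤ Q →
      κd ≤ |A + B * a| / P ∨ κd ≤ P * Q * |(A + B * a) * x + (C + B * b)|)
    (hprim : primOK a b κ P Q x) (hy : |x - y| ≤ 1 / (P ^ 2 * Q)) (hz : |x - z| ≤ 1 / (P ^ 2 * Q))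
    (hby : ¬ primOK a b κ (P * s1) (Q * s2) y) (hbz : ¬ primOK a b κ (P * s1) (Q * s2) z) :
    |y - z| ≤ 4 / (s1 * (P ^ 2 * Q)) := by
  unfold primOK at hby hbz
  push Not at hby hbz
  obtain ⟨p1, q1, r1, hn1, h1a, h1b, h1c⟩ := hby
  obtain ⟨p2, q2, r2, hn2, h2a, h2b, h2c⟩ := hbz
  obtain ⟨a1, a2, a3, a4⟩ := prim_one a b κ P Q s1 s2 x y hP hQ hs1 hs2 hκ hprim p1 q1 r1 hy
    (by tauto) h1a h1b h1c
  obtain ⟨b1, b2, b3, b4⟩ := prim_one a b κ P Q s1 s2 x z hP hQ hs1 hs2 hκ hprim p2 q2 r2 hz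
    (by tauto) h2a h2b h2c
  have hB : (p2 : ℝ) * q1 = p1 * q2 := by
    by_contra hB
    set E1 : ℝ := q1 * x - p1 with hE1
    set E2 : ℝ := q2 * x - p2 with hE2
    set D1 : ℝ := a * p1 + b * q1 - r1 with hD1
    set D2 : ℝ := a * p2 + b * q2 - r2 with hD2
    have eE1 : |E1| ≤ 2 * κ * (s1 * s2) / P := by rw [le_div_iff₀ hP]; linarith
    have eE2 : |E2| ≤ 2 * κ * (s1 * s2) / P := by rw [le_div_iff₀ hP]; linarith
    have eD1 : |D1| ≤ κ / Q := by rw [le_div_iff₀ hQ]; linarith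
    have eD2 : |D2| ≤ κ / Q := by rw [le_div_iff₀ hQ]; linarith
    have hBne : p2 * q1 - p1 * q2 ≠ 0 := by
      intro h; apply hB
      have : ((p2 * q1 - p1 * q2 : ℤ) : ℝ) = 0 := by rw [h]; simp
      push_cast at this; linarith
    have hv := hdual (r1 * q2 - r2 * q1) (p2 * q1 - p1 * q2) (p1 * r2 - p2 * r1)
      (fun h => hBne h.2.1) (by
        push_cast
        have : (p2 : ℝ) * q1 - p1 * q2 = q2 * E1 - q1 * E2 := by rw [hE1, hE2]; ring
        rw [this]
        calc |q2 * E1 - q1 * E2| ≤ |(q2 : ℝ)| * |E1| + |(q1 : ℝ)| * |E2| := by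
              rw [← abs_mul, ← abs_mul]; exact abs_sub _ _
          _ ≤ (κ * (s1 * s2) * (P * Q)) * (2 * κ * (s1 * s2) / P) +
              (κ * (s1 * s2) * (P * Q)) * (2 * κ * (s1 * s2) / P) := by gcongr
          _ = (4 * κ ^ 2 * (s1 * s2) ^ 2) * Q := by field_simp; ring
          _ ≤ 1 * Q := by gcongr
          _ = Q := one_mul _)
    push_cast at hv
    have e1 : (r1 : ℝ) * q2 - r2 * q1 + (p2 * q1 - p1 * q2) * a = q1 * D2 - q2 * D1 := by
      rw [hD1, hD2]; ring
    have e2 : ((r1 : ℝ) * q2 - r2 * q1 + (p2 * q1 - p1 * q2) * a) * x +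
        (p1 * r2 - p2 * r1 + (p2 * q1 - p1 * q2) * b) = E1 * D2 - E2 * D1 := by
      rw [hD1, hD2, hE1, hE2]; ring
    rw [e2, e1] at hv
    rcases hv with hv | hv
    · rw [le_div_iff₀ hP] at hv
      have : |q1 * D2 - q2 * D1| ≤ 4 * κ ^ 2 * (s1 * s2) * P := by
        calc |q1 * D2 - q2 * D1| ≤ |(q1 : ℝ)| * |D2| + |(q2 : ℝ)| * |D1| := by
              rw [← abs_mul, ← abs_mul]; exact abs_sub _ _
          _ ≤ (κ * (s1 * s2) * (P * Q)) * (κ / Q) + (κ * (s1 * s2) * (P * Q)) * (κ / Q) := by gcongr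
          _ = 2 * κ ^ 2 * (s1 * s2) * P := by field_simp; ring
          _ ≤ _ := by gcongr; norm_num
      nlinarith
    · have : P * Q * |E1 * D2 - E2 * D1| ≤ 4 * κ ^ 2 * (s1 * s2) := by
        calc P * Q * |E1 * D2 - E2 * D1| ≤ P * Q * (|E1| * |D2| + |E2| * |D1|) := by
              rw [← abs_mul, ← abs_mul]; gcongr; exact abs_sub _ _
          _ ≤ P * Q * ((2 * κ * (s1 * s2) / P) * (κ / Q) + (2 * κ * (s1 * s2) / P) * (κ / Q)) := by
              gcongr
          _ = _ := by field_simp; ring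
      linarith
  have hq1 : 0 < |(q1 : ℝ)| := lt_of_lt_of_le (by positivity) a1
  have hq2 : 0 < |(q2 : ℝ)| := lt_of_lt_of_le (by positivity) b1
  have hq1' : (q1 : ℝ) ≠ 0 := abs_pos.1 hq1
  have hq2' : (q2 : ℝ) ≠ 0 := abs_pos.1 hq2
  have hyz : y - z = (q1 * y - p1) / q1 - (q2 * z - p2) / q2 := by
    field_simp
    linarith
  have key : ∀ (q e : ℝ), κ * (P * Q) / 2 ≤ |q| → (P * s1) * |e| < κ →
      |e / q| ≤ 2 / (s1 * (P ^ 2 * Q)) := by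
    intro q e h1 h2
    rw [abs_div, div_le_div_iff₀ (lt_of_lt_of_le (by positivity) h1) (by positivity)]
    calc |e| * (s1 * (P ^ 2 * Q)) = (P * s1 * |e|) * (P * Q) := by ring
      _ ≤ κ * (P * Q) := by gcongr
      _ ≤ 2 * |q| := by linarith
  rw [hyz]
  refine (abs_sub _ _).trans ?_
  have k1 := key q1 _ a1 h1b
  have k2 := key q2 _ b1 h2b
  calc _ ≤ 2 / (s1 * (P ^ 2 * Q)) + 2 / (s1 * (P ^ 2 * Q)) := by gcongr
    _ = _ := by ring

lemma inh_step (a b θ1 θ2 κ κ2 P Q s1 s2 x y z : ℝ) (hP : 0 < P) (hQ : 0 < Q)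
    (hs1 : 2 < s1) (hs2 : 1 ≤ s2) (hκ2 : 0 < κ2) (hc : 6 * κ2 * (s1 * s2) ≤ κ)
    (hprim : primOK a b κ P Q x) (hy : |x - y| ≤ 1 / (P ^ 2 * Q)) (hz : |x - z| ≤ 1 / (P ^ 2 * Q))
    (hby : ¬ inhOK a b θ1 θ2 κ2 (P * s1) (Q * s2) (s1 * s2) y)
    (hbz : ¬ inhOK a b θ1 θ2 κ2 (P * s1) (Q * s2) (s1 * s2) z) :
    |y - z| ≤ 4 / (s1 * (P ^ 2 * Q)) := by
  unfold inhOK at hby hbz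
  push Not at hby hbz
  obtain ⟨p1, q1, r1, a1, a2, a3, a4⟩ := hby
  obtain ⟨p2, q2, r2, b1, b2, b3, b4⟩ := hbz
  have hss : 1 < s1 * s2 := by nlinarith
  have hPQ : 0 < P * Q := by positivity
  have eqs : κ2 * (P * s1 * (Q * s2)) / (s1 * s2) = κ2 * (P * Q) := by field_simp
  rw [eqs] at a1 b1
  have key : ∀ (p q r : ℤ) (y : ℝ), |x - y| ≤ 1 / (P ^ 2 * Q) → κ2 * (P * Q) ≤ q →
      (q : ℝ) < κ2 * (P * s1 * (Q * s2)) → P * s1 * |q * y - p - θ1| < 2 * κ2 →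
      Q * s2 * |a * p + b * q - r + (a * θ1 - θ2)| < 2 * κ2 →
      P * |q * x - p - θ1| ≤ κ2 + κ2 * (s1 * s2) ∧
      Q * |a * p + b * q - r + (a * θ1 - θ2)| < 2 * κ2 := by
    intro p q r y hxy h1 h2 h3 h4
    have hq0 : (0 : ℝ) < q := lt_of_lt_of_le (by positivity) h1
    refine ⟨?_, ?_⟩
    · have hE : |q * x - p - θ1| ≤ |q * y - p - θ1| + q * (1 / (P ^ 2 * Q)) := by
        have : (q : ℝ) * x - p - θ1 = (q * y - p - θ1) + q * (x - y) := by ring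
        rw [this]
        refine (abs_add_le _ _).trans ?_
        rw [abs_mul (q : ℝ), abs_of_pos hq0]
        gcongr
      have hE3 : P * |q * y - p - θ1| ≤ κ2 := by
        have h0 : 0 ≤ P * |q * y - p - θ1| := by positivity
        nlinarith
      calc P * |q * x - p - θ1| ≤ P * (|q * y - p - θ1| + q * (1 / (P ^ 2 * Q))) := by gcongr
        _ = P * |q * y - p - θ1| + q / (P * Q) := by field_simp
        _ ≤ κ2 + (κ2 * (P * s1 * (Q * s2))) / (P * Q) := by gcongr
        _ = _ := by field_simp
    · refine lt_of_le_of_lt ?_ h4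
      have : 0 ≤ Q * |a * p + b * q - r + (a * θ1 - θ2)| := by positivity
      nlinarith
  obtain ⟨c1, c2⟩ := key p1 q1 r1 y hy a1 a2 a3 a4
  obtain ⟨d1, d2⟩ := key p2 q2 r2 z hz b1 b2 b3 b4
  have hk6 : κ2 * 6 < κ2 * (6 * (s1 * s2)) := by
    apply mul_lt_mul_of_pos_left _ hκ2; linarith
  have heq : p1 - p2 = 0 ∧ q1 - q2 = 0 ∧ r1 - r2 = 0 := by
    by_contra hne
    rcases hprim _ _ _ hne with h | h | h
    · rw [le_div_iff₀ hPQ] at h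
      push_cast at h
      have : |(q1 : ℝ) - q2| < κ2 * (P * s1 * (Q * s2)) := by
        have : 0 < κ2 * (P * Q) := by positivity
        rw [abs_lt]; constructor <;> linarith
      have h5 : κ2 * (P * s1 * (Q * s2)) = κ2 * (s1 * s2) * (P * Q) := by ring
      have h6 : κ2 * (s1 * s2) * (P * Q) ≤ κ * (P * Q) := by
        gcongr
        have : 0 < κ2 * (s1 * s2) := by positivity
        linarith
      linarith
    · push_cast at h
      have e : ((q1 : ℝ) - q2) * x - (p1 - p2) = (q1 * x - p1 - θ1) - (q2 * x - p2 - θ1) := by ring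
      rw [e] at h
      have := abs_sub (q1 * x - p1 - θ1) (q2 * x - p2 - θ1)
      have : P * |(q1 * x - p1 - θ1) - (q2 * x - p2 - θ1)| ≤
        P * (|q1 * x - p1 - θ1| + |q2 * x - p2 - θ1|) := by gcongr
      nlinarith
    · push_cast at h
      have e : a * ((p1 : ℝ) - p2) + b * (q1 - q2) - (r1 - r2) =
        (a * p1 + b * q1 - r1 + (a * θ1 - θ2)) - (a * p2 + b * q2 - r2 + (a * θ1 - θ2)) := by ring
      rw [e] at h
      have := abs_sub (a * p1 + b * q1 - r1 + (a * θ1 - θ2)) (a * p2 + b * q2 - r2 + (a * θ1 - θ2))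
      have : Q * |(a * p1 + b * q1 - r1 + (a * θ1 - θ2)) - (a * p2 + b * q2 - r2 + (a * θ1 - θ2))| ≤
        Q * (|a * p1 + b * q1 - r1 + (a * θ1 - θ2)| + |a * p2 + b * q2 - r2 + (a * θ1 - θ2)|) := by
          gcongr
      nlinarith
  obtain ⟨e1, e2, -⟩ := heq
  have e1' : p2 = p1 := by omega
  have e2' : q2 = q1 := by omega
  subst e1' e2'
  have hq0 : (0 : ℝ) < q2 := lt_of_lt_of_le (by positivity) a1
  have hyz : (q2 : ℝ) * (y - z) = (q2 * y - p2 - θ1) - (q2 * z - p2 - θ1) := by ring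
  have h7 : (q2 : ℝ) * |y - z| ≤ |q2 * y - p2 - θ1| + |q2 * z - p2 - θ1| := by
    rw [← abs_of_pos hq0, ← abs_mul, abs_of_pos hq0, hyz]; exact abs_sub _ _
  rw [le_div_iff₀ (by positivity)]
  have h8 : κ2 * (P * Q) * |y - z| ≤ q2 * |y - z| := by gcongr
  have h9 : P * s1 * (κ2 * (P * Q) * |y - z|) ≤ 4 * κ2 := by
    calc _ ≤ P * s1 * (|q2 * y - p2 - θ1| + |q2 * z - p2 - θ1|) := by
          gcongr; exact h8.trans h7
      _ ≤ _ := by linarith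
  have h10 : κ2 * (|y - z| * (s1 * (P ^ 2 * Q))) ≤ κ2 * 4 := by linarith
  exact le_of_mul_le_mul_left h10 hκ2

lemma sum_inv_sqrt (n : ℕ) : ∑ m ∈ Finset.range n, 1 / √((m : ℝ) + 1) ≤ 2 * √(n : ℝ) := by
  induction n with
  | zero => simp
  | succ n ih =>
    rw [Finset.sum_range_succ]
    push_cast
    have h1 : √(n : ℝ) ^ 2 = n := Real.sq_sqrt (by positivity)
    have h2 : √((n : ℝ) + 1) ^ 2 = n + 1 := Real.sq_sqrt (by positivity)
    have h3 : 0 < √((n : ℝ) + 1) := by positivity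
    have h4 : 0 ≤ √(n : ℝ) := by positivity
    have h5 : 1 / √((n : ℝ) + 1) ≤ 2 * √((n : ℝ) + 1) - 2 * √(n : ℝ) := by
      rw [div_le_iff₀ h3]
      nlinarith [sq_nonneg (√((n : ℝ) + 1) - √(n : ℝ))]
    linarith

lemma sum_dist (N c : ℕ) (hc : c ≤ N) :
    ∑ k ∈ Finset.range N, 1 / √(|(k : ℝ) - c| + 1) ≤ 4 * √(N : ℝ) := by
  rw [← Finset.sum_range_add_sum_Ico _ hc, ← Finset.sum_range_reflect, Finset.sum_Ico_eq_sum_range]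
  have h1 : ∑ j ∈ Finset.range c, 1 / √(|((c - 1 - j : ℕ) : ℝ) - c| + 1) ≤ 2 * √(c : ℝ) := by
    refine le_trans (Finset.sum_le_sum fun j hj => ?_) (sum_inv_sqrt c)
    rw [Finset.mem_range] at hj
    have e : ((c - 1 - j : ℕ) : ℝ) = c - 1 - j := by
      rw [Nat.cast_sub (by omega), Nat.cast_sub (by omega)]; simp
    rw [e]
    have : (j : ℝ) ≤ |(c : ℝ) - 1 - j - c| := by
      rw [abs_sub_comm]; refine le_trans ?_ (le_abs_self _); linarith
    gcongr
  have h2 : ∑ i ∈ Finset.range (N - c), 1 / √(|((c + i : ℕ) : ℝ) - c| + 1) ≤ 2 * √((N - c : ℕ) : ℝ) := by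
    refine le_trans (Finset.sum_le_sum fun j hj => ?_) (sum_inv_sqrt (N - c))
    push_cast
    have : (j : ℝ) ≤ |(c : ℝ) + j - c| := by
      refine le_trans ?_ (le_abs_self _); linarith
    gcongr
  have h3 : √(c : ℝ) ≤ √(N : ℝ) := by gcongr
  have h4 : √((N - c : ℕ) : ℝ) ≤ √(N : ℝ) := by gcongr; omega
  linarith

lemma sum_dist' (N : ℕ) (ξ : ℝ) :
    ∑ k ∈ Finset.range N, 1 / √(max 1 |(k : ℝ) - ξ|) ≤ 8 * √(N : ℝ) := by
  have hc : ∃ c : ℕ, c ≤ N ∧ ∀ k ∈ Finset.range N, |(k : ℝ) - c| ≤ |(k : ℝ) - ξ| + 1 := by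
    rcases le_total ξ 0 with h | h
    · refine ⟨0, by omega, fun k hk => ?_⟩
      have hk0 : (0 : ℝ) ≤ k := by positivity
      rw [Nat.cast_zero, sub_zero, abs_of_nonneg hk0, abs_of_nonneg (by linarith)]; linarith
    rcases le_total (N : ℝ) ξ with h' | h'
    · refine ⟨N, le_rfl, fun k hk => ?_⟩
      rw [Finset.mem_range] at hk
      have : (k : ℝ) < N := by exact_mod_cast hk
      rw [abs_of_nonpos (by linarith), abs_of_nonpos (by linarith)]; linarith
    · refine ⟨⌊ξ⌋₊, Nat.floor_le_of_le h', fun k hk => ?_⟩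
      have h1 := Nat.floor_le h
      have h2 := Nat.lt_floor_add_one ξ
      have : (k : ℝ) - ⌊ξ⌋₊ = (k - ξ) + (ξ - ⌊ξ⌋₊) := by ring
      rw [this]
      refine (abs_add_le _ _).trans ?_
      have : |ξ - ⌊ξ⌋₊| ≤ 1 := by rw [abs_le]; constructor <;> linarith
      linarith
  obtain ⟨c, hcN, hc⟩ := hc
  calc ∑ k ∈ Finset.range N, 1 / √(max 1 |(k : ℝ) - ξ|)
      ≤ ∑ k ∈ Finset.range N, 2 * (1 / √(|(k : ℝ) - c| + 1)) := by
        refine Finset.sum_le_sum fun k hk => ?_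
        have h1 := hc k hk
        have h2 : |(k : ℝ) - c| + 1 ≤ 4 * max 1 |(k : ℝ) - ξ| := by
          have := le_max_left 1 |(k : ℝ) - ξ|
          have := le_max_right 1 |(k : ℝ) - ξ|
          linarith
        have h3 : √(|(k : ℝ) - c| + 1) ≤ 2 * √(max 1 |(k : ℝ) - ξ|) := by
          calc _ ≤ √(4 * max 1 |(k : ℝ) - ξ|) := by gcongr
            _ = _ := by
              rw [Real.sqrt_mul (by norm_num)]
              congr 1
              rw [show (4 : ℝ) = 2 ^ 2 by norm_num]; exact Real.sqrt_sq (by norm_num)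
        have h4 : 0 < √(max 1 |(k : ℝ) - ξ|) := by positivity
        rw [mul_one_div, div_le_div_iff₀ h4 (by positivity)]
        linarith
    _ = 2 * ∑ k ∈ Finset.range N, 1 / √(|(k : ℝ) - c| + 1) := by rw [Finset.mul_sum]
    _ ≤ 2 * (4 * √(N : ℝ)) := by gcongr; exact sum_dist N c hcN
    _ = _ := by ring

lemma inv_sqrt_scale {A c w : ℝ} (hc : 0 < c) (hw : 0 < w) (h : c ^ 2 * w ≤ A) :
    1 / √A ≤ (1 / c) * (1 / √w) := by
  have : c * √w ≤ √A := by
    apply Real.le_sqrt_of_sq_le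
    rw [mul_pow, Real.sq_sqrt hw.le]; exact h
  have e : (1 / c) * (1 / √w) = 1 / (c * √w) := by rw [one_div_mul_one_div]
  rw [e]
  exact one_div_le_one_div_of_le (by positivity) this

lemma contraction (N : ℕ) (hN : 0 < N) (s1 S f α : ℝ) (hs1 : 1 ≤ s1) (hS : 1 ≤ S)
    (hNS : (N : ℝ) = s1 * S) (hne : 0 < max |α| |f|) :
    ∑ k ∈ Finset.range N, 1 / √(max (|α| / s1) (S * |f + (k : ℝ) / N * α|)) ≤
      16 * N / √S * (1 / √(max |α| |f|)) := by
  have hNp : (0 : ℝ) < N := by exact_mod_cast hN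
  have hSp : 0 < S := by linarith
  have hsS : 0 < √S := by positivity
  by_cases hc : 2 * |α| ≤ |f|
  · have hmax : max |α| |f| = |f| := by
      apply max_eq_right; have := abs_nonneg α; linarith
    rw [hmax] at hne ⊢
    have : ∀ k ∈ Finset.range N, 1 / √(max (|α| / s1) (S * |f + (k : ℝ) / N * α|)) ≤
        16 / √S * (1 / √|f|) := by
      intro k hk
      rw [Finset.mem_range] at hk
      have h1 : |f| / 2 ≤ |f + (k : ℝ) / N * α| := by
        have hk1 : (k : ℝ) / N ≤ 1 := by
          rw [div_le_one hNp]; exact_mod_cast hk.le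
        have h2 : |(k : ℝ) / N * α| ≤ |α| := by
          rw [abs_mul, abs_of_nonneg (by positivity)]
          exact mul_le_of_le_one_left (abs_nonneg _) hk1
        have h3 := abs_sub_abs_le_abs_sub f (-((k : ℝ) / N * α))
        rw [abs_neg, sub_neg_eq_add] at h3
        linarith
      have h4 : (√S / 2) ^ 2 * |f| ≤ max (|α| / s1) (S * |f + (k : ℝ) / N * α|) := by
        refine le_trans ?_ (le_max_right _ _)
        rw [div_pow, Real.sq_sqrt hSp.le]
        nlinarith [abs_nonneg f]
      refine (inv_sqrt_scale (by positivity) hne h4).trans ?_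
      rw [one_div_div]
      gcongr
      norm_num
    refine (Finset.sum_le_sum this).trans ?_
    rw [Finset.sum_const, Finset.card_range, nsmul_eq_mul]
    apply le_of_eq; ring
  · push Not at hc
    have hα : 0 < |α| := by have := abs_nonneg f; linarith
    have hα' : α ≠ 0 := abs_pos.1 hα
    set ξ := -(f * N / α) with hξ
    have : ∀ k ∈ Finset.range N, 1 / √(max (|α| / s1) (S * |f + (k : ℝ) / N * α|)) =
        (√N / √S * (1 / √|α|)) * (1 / √(max 1 |(k : ℝ) - ξ|)) := by
      intro k hk
      have h1 : f + (k : ℝ) / N * α = (α / N) * (k - ξ) := by rw [hξ]; field_simp; ring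
      have h2 : max (|α| / s1) (S * |f + (k : ℝ) / N * α|) = (S * |α| / N) * max 1 |(k : ℝ) - ξ| := by
        rw [h1, abs_mul, abs_div, abs_of_pos hNp, mul_max_of_nonneg _ _ (by positivity)]
        congr 1
        · rw [hNS]; field_simp
        · ring
      rw [h2, Real.sqrt_mul (by positivity), Real.sqrt_div (by positivity), Real.sqrt_mul hSp.le]
      field_simp
    rw [Finset.sum_congr rfl this, ← Finset.mul_sum]
    have h5 : 1 / √|α| ≤ 2 * (1 / √(max |α| |f|)) := by
      have := inv_sqrt_scale (A := |α|) (c := 1 / 2) (w := max |α| |f|) (by norm_num) hne (by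
        have : max |α| |f| ≤ 4 * |α| := max_le (by linarith) (by linarith)
        linarith)
      simpa using this
    calc _ ≤ (√N / √S * (2 * (1 / √(max |α| |f|)))) * (8 * √(N : ℝ)) := by
          gcongr; exact sum_dist' N ξ
      _ = 16 * (√N * √N) / √S * (1 / √(max |α| |f|)) := by ring
      _ = _ := by rw [Real.mul_self_sqrt hNp.le]

/-- Primitive, sign-normalised integer vectors. -/
def isPrim (v : ℤ × ℤ × ℤ) : Prop :=
  (∃ l m n : ℤ, l * v.1 + m * v.2.1 + n * v.2.2 = 1) ∧
  (0 < v.1 ∨ (v.1 = 0 ∧ (0 < v.2.1 ∨ (v.2.1 = 0 ∧ 0 < v.2.2))))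

lemma isPrim_ne {v : ℤ × ℤ × ℤ} (h : isPrim v) : ¬ (v.1 = 0 ∧ v.2.1 = 0 ∧ v.2.2 = 0) := by
  rintro ⟨h1, h2, h3⟩
  rcases h.2 with h | ⟨_, h | ⟨_, h⟩⟩ <;> omega

lemma isPrim_unique {v w : ℤ × ℤ × ℤ} (hv : isPrim v) (hw : isPrim w)
    (h1 : v.1 * w.2.1 = w.1 * v.2.1) (h2 : v.1 * w.2.2 = w.1 * v.2.2)
    (h3 : v.2.1 * w.2.2 = w.2.1 * v.2.2) : v = w := by
  obtain ⟨A, B, C⟩ := v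
  obtain ⟨A', B', C'⟩ := w
  simp only at h1 h2 h3
  obtain ⟨⟨l, m, n, hl⟩, pv⟩ := hv
  obtain ⟨⟨l', m', n', hl'⟩, pw⟩ := hw
  simp only at hl hl' pv pw
  set t := l * A' + m * B' + n * C' with ht
  have eA : A' = t * A := by linear_combination (-A') * hl - m * h1 - n * h2
  have eB : B' = t * B := by linear_combination (-B') * hl + l * h1 - n * h3
  have eC : C' = t * C := by linear_combination (-C') * hl + l * h2 + m * h3
  have hu : t * (l' * A + m' * B + n' * C) = 1 := by
    rw [eA, eB, eC] at hl'; linear_combination hl'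
  rcases Int.isUnit_iff.1 (IsUnit.of_mul_eq_one _ hu) with h | h
  · rw [h] at eA eB eC; simp [eA, eB, eC]
  · rw [h] at eA eB eC
    exfalso
    omega

lemma exists_prim (A B C : ℤ) (h : ¬ (A = 0 ∧ B = 0 ∧ C = 0)) :
    ∃ (g : ℤ) (v : ℤ × ℤ × ℤ), g ≠ 0 ∧ isPrim v ∧ A = g * v.1 ∧ B = g * v.2.1 ∧ C = g * v.2.2 := by
  have key : ∃ (g A' B' C' : ℤ), g ≠ 0 ∧ (∃ l m n : ℤ, l * A' + m * B' + n * C' = 1) ∧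
      A = g * A' ∧ B = g * B' ∧ C = g * C' := by
    set d : ℤ := gcd B C with hd
    set g : ℤ := gcd A d with hg
    have hg0 : g ≠ 0 := by
      intro h0
      rw [hg, gcd_eq_zero_iff] at h0
      obtain ⟨hA, hd0⟩ := h0
      rw [hd, gcd_eq_zero_iff] at hd0
      exact h ⟨hA, hd0⟩
    obtain ⟨x, y, hxy⟩ := exists_gcd_eq_mul_add_mul A d
    obtain ⟨z, w, hzw⟩ := exists_gcd_eq_mul_add_mul B C
    rw [← hg] at hxy
    rw [← hd] at hzw
    obtain ⟨A', hA'⟩ : g ∣ A := gcd_dvd_left _ _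
    have hgd : g ∣ d := gcd_dvd_right _ _
    obtain ⟨B', hB'⟩ : g ∣ B := hgd.trans (gcd_dvd_left _ _)
    obtain ⟨C', hC'⟩ : g ∣ C := hgd.trans (gcd_dvd_right _ _)
    refine ⟨g, A', B', C', hg0, ⟨x, z * y, w * y, ?_⟩, hA', hB', hC'⟩
    apply mul_left_cancel₀ hg0
    linear_combination (-x) * hA' - (z * y) * hB' - (w * y) * hC' - hxy - y * hzw
  obtain ⟨g, A', B', C', hg, ⟨l, m, n, hl⟩, hA, hB, hC⟩ := key
  by_cases hpos : (0 < A' ∨ (A' = 0 ∧ (0 < B' ∨ (B' = 0 ∧ 0 < C'))))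
  · exact ⟨g, (A', B', C'), hg, ⟨⟨l, m, n, hl⟩, hpos⟩, hA, hB, hC⟩
  · refine ⟨-g, (-A', -B', -C'), by simpa using hg, ⟨⟨-l, -m, -n, by simp only; linarith⟩, ?_⟩,
      by simp [hA], by simp [hB], by simp [hC]⟩
    have hne : ¬ (A' = 0 ∧ B' = 0 ∧ C' = 0) := by
      rintro ⟨rfl, rfl, rfl⟩; simp at hl
    simp only
    omega

/-- The expanding part of a dual vector at scale `(P, Q)` and point `x`. -/
noncomputable def wf (a b P Q x : ℝ) (v : ℤ × ℤ × ℤ) : ℝ :=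
  max (|v.1 + v.2.1 * a| / P) (P * Q * |(v.1 + v.2.1 * a) * x + (v.2.2 + v.2.1 * b)|)

/-- The contracting part of a dual vector at scale `Q`. -/
noncomputable def hf (Q : ℝ) (v : ℤ × ℤ × ℤ) : ℝ := max 1 (|(v.2.1 : ℝ)| / Q)

/-- Weight of a dual vector. -/
noncomputable def phi (a b η P Q x : ℝ) (v : ℤ × ℤ × ℤ) : ℝ :=
  1 / √(wf a b P Q x v) * hf Q v ^ (-(η / 2))

/-- Relevant dual vectors. -/
def rel (a b η0 κ1 P Q x : ℝ) (v : ℤ × ℤ × ℤ) : Prop :=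
  isPrim v ∧ wf a b P Q x v * hf Q v ^ η0 < κ1

open Classical in
/-- The potential. -/
noncomputable def Phi (a b η η0 κ1 P Q x : ℝ) : ENNReal :=
  ∑' v : ℤ × ℤ × ℤ, if rel a b η0 κ1 P Q x v then ENNReal.ofReal (phi a b η P Q x v) else 0

lemma one_le_hf (Q : ℝ) (v : ℤ × ℤ × ℤ) : 1 ≤ hf Q v := le_max_left _ _

lemma phi_nonneg (a b η P Q x : ℝ) (v : ℤ × ℤ × ℤ) : 0 ≤ phi a b η P Q x v := by
  have := one_le_hf Q v
  unfold phi; positivity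

lemma hf_le (Q s2 : ℝ) (hQ : 0 < Q) (hs2 : 1 ≤ s2) (v : ℤ × ℤ × ℤ) :
    hf Q v ≤ s2 * hf (Q * s2) v := by
  unfold hf
  rw [mul_max_of_nonneg _ _ (by linarith)]
  apply max_le_max
  · linarith
  · apply le_of_eq; field_simp

lemma phi_contr (a b η P Q s1 s2 x : ℝ) (N : ℕ) (hN : 0 < N) (v : ℤ × ℤ × ℤ) (hη : 0 ≤ η)
    (hP : 0 < P) (hQ : 0 < Q) (hs1 : 1 ≤ s1) (hs2 : 1 ≤ s2) (hNS : (N : ℝ) = s1 * (s1 * s2))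
    (hw : 0 < wf a b P Q x v) :
    ∑ k ∈ Finset.range N, phi a b η (P * s1) (Q * s2) (x + (k : ℝ) / (P ^ 2 * Q * N)) v ≤
      N * (16 * s2 ^ (η / 2) / √(s1 * s2)) * phi a b η P Q x v := by
  have hNp : (0 : ℝ) < N := by exact_mod_cast hN
  set α : ℝ := (v.1 + v.2.1 * a) / P with hα
  set f : ℝ := P * Q * ((v.1 + v.2.1 * a) * x + (v.2.2 + v.2.1 * b)) with hf'
  have e0 : wf a b P Q x v = max |α| |f| := by
    unfold wf
    rw [hα, hf', abs_div, abs_of_pos hP, abs_mul (P * Q), abs_of_pos (by positivity : 0 < P * Q)]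
  have e1 : ∀ k : ℕ, wf a b (P * s1) (Q * s2) (x + (k : ℝ) / (P ^ 2 * Q * N)) v =
      max (|α| / s1) ((s1 * s2) * |f + (k : ℝ) / N * α|) := by
    intro k
    unfold wf
    congr 1
    · rw [hα, abs_div, abs_of_pos hP, div_div]
    · have hpos : 0 < P * Q := by positivity
      have : f + (k : ℝ) / N * α = (P * Q) * ((v.1 + v.2.1 * a) * (x + (k : ℝ) / (P ^ 2 * Q * N)) +
          (v.2.2 + v.2.1 * b)) := by
        rw [hf', hα]; field_simp; ring
      rw [this, abs_mul (P * Q), abs_of_pos hpos]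
      ring
  have hS : 1 ≤ s1 * s2 := by nlinarith
  have hc := contraction N hN s1 (s1 * s2) f α hs1 hS hNS (by rwa [← e0])
  have h1 := one_le_hf Q v
  have h2 := one_le_hf (Q * s2) v
  have h3 : hf (Q * s2) v ^ (-(η / 2)) ≤ s2 ^ (η / 2) * hf Q v ^ (-(η / 2)) := by
    have h4 : hf Q v ^ (η / 2) ≤ s2 ^ (η / 2) * hf (Q * s2) v ^ (η / 2) := by
      rw [← Real.mul_rpow (by linarith) (by linarith)]
      exact Real.rpow_le_rpow (by linarith) (hf_le Q s2 hQ hs2 v) (by linarith)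
    rw [Real.rpow_neg (by linarith), Real.rpow_neg (by linarith), ← div_eq_mul_inv,
      inv_eq_one_div, div_le_div_iff₀ (by positivity) (by positivity)]
    linarith
  unfold phi
  calc ∑ k ∈ Finset.range N, 1 / √(wf a b (P * s1) (Q * s2) (x + (k : ℝ) / (P ^ 2 * Q * N)) v) *
        hf (Q * s2) v ^ (-(η / 2))
      = (∑ k ∈ Finset.range N, 1 / √(max (|α| / s1) ((s1 * s2) * |f + (k : ℝ) / N * α|))) *
        hf (Q * s2) v ^ (-(η / 2)) := by
        rw [Finset.sum_mul]
        refine Finset.sum_congr rfl fun k _ => ?_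
        rw [e1]
    _ ≤ (16 * N / √(s1 * s2) * (1 / √(max |α| |f|))) * (s2 ^ (η / 2) * hf Q v ^ (-(η / 2))) := by
        gcongr
    _ = _ := by rw [e0]; ring

lemma rel_bound (a b η0 κ1 P Q s1 s2 x y : ℝ) (v : ℤ × ℤ × ℤ) (hP : 0 < P) (hQ : 0 < Q)
    (hs1 : 1 ≤ s1) (hs2 : 1 ≤ s2) (hη0 : 1 ≤ η0) (hsη : s2 ^ η0 ≤ s1 * s2) (hκ1 : 0 < κ1)
    (hxy : |x - y| ≤ 1 / (P ^ 2 * Q)) (h : rel a b η0 κ1 (P * s1) (Q * s2) y v) :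
    wf a b P Q x v * hf Q v ≤ 2 * (s1 * s2) ^ 2 * κ1 := by
  obtain ⟨-, h⟩ := h
  set H := hf Q v with hH
  set H' := hf (Q * s2) v with hH'
  set S := s1 * s2 with hS
  have hS1 : 1 ≤ S := by rw [hS]; nlinarith
  have h1 : 1 ≤ H := one_le_hf Q v
  have h2 : 1 ≤ H' := one_le_hf (Q * s2) v
  have hHH : H ≤ s2 * H' := hf_le Q s2 hQ hs2 v
  set w' := wf a b (P * s1) (Q * s2) y v with hw'
  have hw0 : 0 ≤ w' := by
    rw [hw']; unfold wf; refine le_trans ?_ (le_max_left _ _); positivity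
  have hw1 : w' * H ≤ S * κ1 := by
    calc w' * H ≤ w' * H ^ η0 := by
          gcongr
          calc H = H ^ (1 : ℝ) := (Real.rpow_one H).symm
            _ ≤ H ^ η0 := Real.rpow_le_rpow_of_exponent_le h1 hη0
      _ ≤ w' * (s2 * H') ^ η0 := by gcongr
      _ = s2 ^ η0 * (w' * H' ^ η0) := by
          rw [Real.mul_rpow (by linarith) (by linarith)]; ring
      _ ≤ S * κ1 := by gcongr
  set A' : ℝ := v.1 + v.2.1 * a with hA'
  have a1 : |A'| / (P * s1) ≤ w' := le_max_left _ _
  have a2 : (P * s1) * (Q * s2) * |A' * y + (v.2.2 + v.2.1 * b)| ≤ w' := le_max_right _ _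
  have hs1S : s1 ≤ S := by rw [hS]; nlinarith
  have b1 : |A'| / P ≤ S * w' := by
    calc |A'| / P = s1 * (|A'| / (P * s1)) := by field_simp
      _ ≤ S * w' := by gcongr
  have b2 : P * Q * |A' * y + (v.2.2 + v.2.1 * b)| ≤ S * w' := by
    have h0 : 0 ≤ P * Q * |A' * y + (v.2.2 + v.2.1 * b)| := by positivity
    have h3 : S * (P * Q * |A' * y + (v.2.2 + v.2.1 * b)|) ≤ w' := by
      refine le_trans (le_of_eq ?_) a2; rw [hS]; ring
    nlinarith
  have b3 : P * Q * |A' * x + (v.2.2 + v.2.1 * b)| ≤ 2 * (S * w') := by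
    have e : A' * x + (v.2.2 + v.2.1 * b) = (A' * y + (v.2.2 + v.2.1 * b)) + A' * (x - y) := by ring
    rw [e]
    calc P * Q * |(A' * y + (v.2.2 + v.2.1 * b)) + A' * (x - y)|
        ≤ P * Q * (|A' * y + (v.2.2 + v.2.1 * b)| + |A'| * (1 / (P ^ 2 * Q))) := by
          gcongr
          refine (abs_add_le _ _).trans ?_
          rw [abs_mul A']
          gcongr
      _ = P * Q * |A' * y + (v.2.2 + v.2.1 * b)| + |A'| / P := by field_simp
      _ ≤ _ := by linarith
  have b4 : wf a b P Q x v ≤ 2 * (S * w') := by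
    unfold wf
    apply max_le _ b3
    have : 0 ≤ S * w' := by positivity
    exact b1.trans (by linarith)
  calc wf a b P Q x v * H ≤ 2 * (S * w') * H := by gcongr
    _ = 2 * S * (w' * H) := by ring
    _ ≤ 2 * S * (S * κ1) := by gcongr
    _ = _ := by ring

/-- The dyadic scale of a dual vector. -/
noncomputable def lev (Q : ℝ) (v : ℤ × ℤ × ℤ) : ℕ := Nat.log 2 ⌊hf Q v⌋₊

lemma lev_spec (Q : ℝ) (v : ℤ × ℤ × ℤ) :
    (2 : ℝ) ^ lev Q v ≤ hf Q v ∧ hf Q v ≤ 2 * 2 ^ lev Q v := by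
  have h1 := one_le_hf Q v
  have h2 : ⌊hf Q v⌋₊ ≠ 0 := by
    exact (Nat.floor_pos.2 h1).ne'
  constructor
  · have h3 := Nat.pow_log_le_self 2 h2
    calc (2 : ℝ) ^ lev Q v ≤ (⌊hf Q v⌋₊ : ℝ) := by exact_mod_cast h3
      _ ≤ _ := Nat.floor_le (by linarith)
  · have h3 := Nat.lt_pow_succ_log_self (b := 2) (by norm_num) ⌊hf Q v⌋₊
    have h4 : (⌊hf Q v⌋₊ : ℝ) + 1 ≤ 2 ^ (lev Q v + 1) := by exact_mod_cast h3
    have h5 := Nat.lt_floor_add_one (hf Q v)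
    rw [pow_succ] at h4
    linarith

lemma dual_unique (a b κ L P Q x : ℝ) (v1 v2 : ℤ × ℤ × ℤ) (hP : 0 < P) (hQ : 0 < Q)
    (hL1 : 4 * L < κ) (hL0 : 0 ≤ L) (hL : L ≤ 1)
    (hprim : primOK a b κ P Q x) (hv1 : isPrim v1) (hv2 : isPrim v2)
    (h1 : wf a b P Q x v1 * hf Q v1 ≤ L) (h2 : wf a b P Q x v2 * hf Q v2 ≤ L)
    (hl : lev Q v1 = lev Q v2) : v1 = v2 := by
  have s1 := lev_spec Q v1
  have s2 := lev_spec Q v2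
  rw [hl] at s1
  have hH12 : hf Q v1 ≤ 2 * hf Q v2 := by linarith
  have hH21 : hf Q v2 ≤ 2 * hf Q v1 := by linarith
  have o1 := one_le_hf Q v1
  have o2 := one_le_hf Q v2
  obtain ⟨A1, B1, C1⟩ := v1
  obtain ⟨A2, B2, C2⟩ := v2
  set H1 := hf Q (A1, B1, C1) with hH1
  set H2 := hf Q (A2, B2, C2) with hH2
  have k1 : |(B1 : ℝ)| ≤ Q * H1 := by
    have : |(B1 : ℝ)| / Q ≤ H1 := le_max_right _ _
    rw [div_le_iff₀ hQ] at this; linarith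
  have k2 : |(B2 : ℝ)| ≤ Q * H2 := by
    have : |(B2 : ℝ)| / Q ≤ H2 := le_max_right _ _
    rw [div_le_iff₀ hQ] at this; linarith
  set A1' : ℝ := A1 + B1 * a with hA1
  set A2' : ℝ := A2 + B2 * a with hA2
  set F1 : ℝ := A1' * x + (C1 + B1 * b) with hF1
  set F2 : ℝ := A2' * x + (C2 + B2 * b) with hF2
  have hH1p : 0 < H1 := by linarith
  have hH2p : 0 < H2 := by linarith
  have m1 : |A1'| ≤ P * L / H1 := by
    have : |A1'| / P ≤ wf a b P Q x (A1, B1, C1) := le_max_left _ _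
    have : |A1'| / P * H1 ≤ L := le_trans (by gcongr) h1
    rw [le_div_iff₀ hH1p]
    calc |A1'| * H1 = P * (|A1'| / P * H1) := by field_simp
      _ ≤ _ := by gcongr
  have m2 : |A2'| ≤ P * L / H2 := by
    have : |A2'| / P ≤ wf a b P Q x (A2, B2, C2) := le_max_left _ _
    have : |A2'| / P * H2 ≤ L := le_trans (by gcongr) h2
    rw [le_div_iff₀ hH2p]
    calc |A2'| * H2 = P * (|A2'| / P * H2) := by field_simp
      _ ≤ _ := by gcongr
  have n1 : |F1| ≤ L / (P * Q * H1) := by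
    have : P * Q * |F1| ≤ wf a b P Q x (A1, B1, C1) := le_max_right _ _
    have : P * Q * |F1| * H1 ≤ L := le_trans (by gcongr) h1
    rw [le_div_iff₀ (by positivity)]
    linarith
  have n2 : |F2| ≤ L / (P * Q * H2) := by
    have : P * Q * |F2| ≤ wf a b P Q x (A2, B2, C2) := le_max_right _ _
    have : P * Q * |F2| * H2 ≤ L := le_trans (by gcongr) h2
    rw [le_div_iff₀ (by positivity)]
    linarith
  have hu : C2 * B1 - C1 * B2 = 0 ∧ A1 * B2 - A2 * B1 = 0 ∧ A2 * C1 - A1 * C2 = 0 := by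
    by_contra hne
    rcases hprim _ _ _ hne with h | h | h
    · rw [le_div_iff₀ (by positivity)] at h
      push_cast at h
      have e : (A1 : ℝ) * B2 - A2 * B1 = A1' * B2 - A2' * B1 := by rw [hA1, hA2]; ring
      rw [e] at h
      have : |A1' * B2 - A2' * B1| ≤ 4 * L * (P * Q) := by
        calc |A1' * B2 - A2' * B1| ≤ |A1'| * |(B2 : ℝ)| + |A2'| * |(B1 : ℝ)| := by
              rw [← abs_mul, ← abs_mul]; exact abs_sub _ _
          _ ≤ (P * L / H1) * (Q * H2) + (P * L / H2) * (Q * H1) := by gcongr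
          _ ≤ (P * L / H1) * (Q * (2 * H1)) + (P * L / H2) * (Q * (2 * H2)) := by gcongr
          _ = _ := by field_simp; ring
      have : 4 * L * (P * Q) < κ * (P * Q) := by gcongr
      linarith
    · push_cast at h
      have e : ((A1 : ℝ) * B2 - A2 * B1) * x - (C2 * B1 - C1 * B2) = F1 * B2 - F2 * B1 := by
        rw [hF1, hF2, hA1, hA2]; ring
      rw [e] at h
      have : P * |F1 * B2 - F2 * B1| ≤ 4 * L := by
        calc P * |F1 * B2 - F2 * B1| ≤ P * (|F1| * |(B2 : ℝ)| + |F2| * |(B1 : ℝ)|) := by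
              gcongr
              rw [← abs_mul, ← abs_mul]; exact abs_sub _ _
          _ ≤ P * ((L / (P * Q * H1)) * (Q * H2) + (L / (P * Q * H2)) * (Q * H1)) := by gcongr
          _ ≤ P * ((L / (P * Q * H1)) * (Q * (2 * H1)) + (L / (P * Q * H2)) * (Q * (2 * H2))) := by
              gcongr
          _ = _ := by field_simp; ring
      linarith
    · push_cast at h
      have e : a * ((C2 : ℝ) * B1 - C1 * B2) + b * (A1 * B2 - A2 * B1) - (A2 * C1 - A1 * C2) =
          A1' * F2 - A2' * F1 := by
        rw [hF1, hF2, hA1, hA2]; ring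
      rw [e] at h
      have : Q * |A1' * F2 - A2' * F1| ≤ 4 * L := by
        calc Q * |A1' * F2 - A2' * F1| ≤ Q * (|A1'| * |F2| + |A2'| * |F1|) := by
              gcongr
              rw [← abs_mul, ← abs_mul]; exact abs_sub _ _
          _ ≤ Q * ((P * L / H1) * (L / (P * Q * H2)) + (P * L / H2) * (L / (P * Q * H1))) := by
              gcongr
          _ ≤ Q * ((P * L / 1) * (L / (P * Q * 1)) + (P * L / 1) * (L / (P * Q * 1))) := by
              gcongr
          _ = 2 * (L * L) := by field_simp; ring
          _ ≤ 4 * L := by nlinarith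
      linarith
  obtain ⟨u1, u2, u3⟩ := hu
  apply isPrim_unique hv1 hv2 <;> simp only <;> linarith

theorem dual_step (a b η η0 κ κ1 P Q s1 s2 x : ℝ) (N : ℕ) (M : ENNReal) (hN : 0 < N)
    (hP : 0 < P) (hQ : 0 < Q) (hs1 : 1 ≤ s1) (hs2 : 1 ≤ s2) (hNS : (N : ℝ) = s1 * (s1 * s2))
    (hη0 : 1 ≤ η0) (hη : η0 < η) (hsη : s2 ^ η0 ≤ s1 * s2) (hκ1 : 0 < κ1)
    (hκ : 8 * (s1 * s2) ^ 2 * κ1 < κ) (hκ' : κ ≤ 1)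
    (hw : ∀ v : ℤ × ℤ × ℤ, isPrim v → 0 < wf a b P Q x v)
    (hprim : primOK a b κ P Q x)
    (hM : ENNReal.ofReal (1 / √κ1) * ∑' l : ℕ, ENNReal.ofReal ((2 ^ (-((η - η0) / 2)) : ℝ) ^ l) ≤ M)
    (hPhi : Phi a b η η0 κ1 P Q x ≤ M) :
    ∑ k ∈ Finset.range N, Phi a b η η0 κ1 (P * s1) (Q * s2) (x + (k : ℝ) / (P ^ 2 * Q * N)) ≤
      ENNReal.ofReal (N * (16 * s2 ^ (η / 2) / √(s1 * s2))) * (2 * M) := by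
  classical
  set y : ℕ → ℝ := fun k => x + (k : ℝ) / (P ^ 2 * Q * N) with hy
  set c : ℝ := N * (16 * s2 ^ (η / 2) / √(s1 * s2)) with hc
  have hNp : (0 : ℝ) < N := by exact_mod_cast hN
  have hc0 : 0 ≤ c := by positivity
  set U : Set (ℤ × ℤ × ℤ) := {v | ∃ k ∈ Finset.range N, rel a b η0 κ1 (P * s1) (Q * s2) (y k) v}
    with hU
  have hxy : ∀ k ∈ Finset.range N, |x - y k| ≤ 1 / (P ^ 2 * Q) := by
    intro k hk
    rw [Finset.mem_range] at hk
    have e : x - y k = -((k : ℝ) / (P ^ 2 * Q * N)) := by rw [hy]; ring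
    rw [e, abs_neg, abs_of_nonneg (by positivity), div_le_div_iff₀ (by positivity) (by positivity)]
    have : (k : ℝ) ≤ N := by exact_mod_cast hk.le
    have hp : 0 < P ^ 2 * Q := by positivity
    nlinarith
  have hUp : ∀ v ∈ U, isPrim v := by rintro v ⟨k, _, h⟩; exact h.1
  have hUb : ∀ v ∈ U, wf a b P Q x v * hf Q v ≤ 2 * (s1 * s2) ^ 2 * κ1 := by
    rintro v ⟨k, hk, h⟩
    exact rel_bound a b η0 κ1 P Q s1 s2 x (y k) v hP hQ hs1 hs2 hη0 hsη hκ1 (hxy k hk) h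
  have hUi : ∀ v ∈ U, ∀ w ∈ U, lev Q v = lev Q w → v = w := by
    intro v hv w hw' hl
    exact dual_unique a b κ (2 * (s1 * s2) ^ 2 * κ1) P Q x v w hP hQ (by linarith) (by positivity)
      (by linarith) hprim (hUp v hv) (hUp w hw') (hUb v hv) (hUb w hw') hl
  have step1 : ∑ k ∈ Finset.range N, Phi a b η η0 κ1 (P * s1) (Q * s2) (y k) ≤
      ENNReal.ofReal c * ∑' v : ℤ × ℤ × ℤ,
        if v ∈ U then ENNReal.ofReal (phi a b η P Q x v) else 0 := by
    unfold Phi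
    rw [← ENNReal.tsum_mul_left, ← Summable.tsum_finsetSum (fun _ _ => ENNReal.summable)]
    refine ENNReal.tsum_le_tsum fun v => ?_
    by_cases hv : v ∈ U
    · rw [if_pos hv, ← ENNReal.ofReal_mul hc0]
      calc _ ≤ ∑ k ∈ Finset.range N, ENNReal.ofReal (phi a b η (P * s1) (Q * s2) (y k) v) := by
            refine Finset.sum_le_sum fun k _ => ?_
            split_ifs
            · exact le_rfl
            · exact zero_le
        _ = ENNReal.ofReal (∑ k ∈ Finset.range N, phi a b η (P * s1) (Q * s2) (y k) v) := by
            rw [ENNReal.ofReal_sum_of_nonneg (fun k _ => phi_nonneg _ _ _ _ _ _ _)]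
        _ ≤ _ := by
            apply ENNReal.ofReal_le_ofReal
            exact phi_contr a b η P Q s1 s2 x N hN v (by linarith) hP hQ hs1 hs2 hNS (hw v (hUp v hv))
    · rw [if_neg hv, mul_zero]
      apply le_of_eq
      refine Finset.sum_eq_zero fun k hk => ?_
      rw [if_neg]
      intro h
      exact hv ⟨k, hk, h⟩
  refine step1.trans ?_
  gcongr
  set ρ : ℝ := 2 ^ (-((η - η0) / 2)) with hρ
  set G : ENNReal := ENNReal.ofReal (1 / √κ1) with hG
  have step2 : ∀ v : ℤ × ℤ × ℤ, (if v ∈ U then ENNReal.ofReal (phi a b η P Q x v) else 0) ≤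
      (if rel a b η0 κ1 P Q x v then ENNReal.ofReal (phi a b η P Q x v) else 0) +
      (if v ∈ U then G * ENNReal.ofReal (ρ ^ lev Q v) else 0) := by
    intro v
    by_cases hv : v ∈ U
    swap
    · simp [hv]
    rw [if_pos hv, if_pos hv]
    by_cases hr : rel a b η0 κ1 P Q x v
    · rw [if_pos hr]; exact le_self_add
    rw [if_neg hr, zero_add, hG, ← ENNReal.ofReal_mul (by positivity)]
    apply ENNReal.ofReal_le_ofReal
    have hr' : κ1 ≤ wf a b P Q x v * hf Q v ^ η0 := by
      by_contra hcon
      exact hr ⟨hUp v hv, not_le.1 hcon⟩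
    have hh := one_le_hf Q v
    have hhp : 0 < hf Q v := by linarith
    have hwp := hw v (hUp v hv)
    unfold phi
    have p1 : 1 / √(wf a b P Q x v) ≤ 1 / √κ1 * hf Q v ^ (η0 / 2) := by
      have e : √(hf Q v ^ η0) = hf Q v ^ (η0 / 2) := by
        rw [Real.sqrt_eq_rpow, ← Real.rpow_mul hhp.le]; congr 1; ring
      have := Real.sqrt_le_sqrt hr'
      rw [Real.sqrt_mul hwp.le, e] at this
      rw [one_div_mul_eq_div, div_le_div_iff₀ (by positivity) (by positivity)]
      linarith
    calc 1 / √(wf a b P Q x v) * hf Q v ^ (-(η / 2))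
        ≤ (1 / √κ1 * hf Q v ^ (η0 / 2)) * hf Q v ^ (-(η / 2)) := by gcongr
      _ = 1 / √κ1 * hf Q v ^ (-((η - η0) / 2)) := by
          rw [mul_assoc, ← Real.rpow_add hhp]; congr 2; ring
      _ ≤ 1 / √κ1 * ((2 : ℝ) ^ lev Q v) ^ (-((η - η0) / 2)) := by
          have := (lev_spec Q v).1
          gcongr 1 / √κ1 * ?_
          exact Real.rpow_le_rpow_of_nonpos (by positivity) this (by linarith)
      _ = _ := by
          congr 1
          rw [hρ, ← Real.rpow_natCast, ← Real.rpow_natCast, ← Real.rpow_mul (by norm_num),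
            ← Real.rpow_mul (by norm_num)]
          congr 1; ring
  refine (ENNReal.tsum_le_tsum step2).trans ?_
  rw [ENNReal.tsum_add, two_mul]
  refine add_le_add hPhi (le_trans ?_ hM)
  have e3 : ∑' v : ℤ × ℤ × ℤ, (if v ∈ U then G * ENNReal.ofReal (ρ ^ lev Q v) else 0) =
      ∑' v : U, G * ENNReal.ofReal (ρ ^ lev Q (v : ℤ × ℤ × ℤ)) := by
    rw [tsum_subtype U (fun v => G * ENNReal.ofReal (ρ ^ lev Q v))]
    refine tsum_congr fun v => ?_
    by_cases hv : v ∈ U <;> simp [hv]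
  rw [e3, ENNReal.tsum_mul_left]
  gcongr
  exact ENNReal.tsum_comp_le_tsum_of_injective
    (f := fun v : U => lev Q (v : ℤ × ℤ × ℤ))
    (fun v w h => Subtype.ext (hUi v v.2 w w.2 h)) (fun l => ENNReal.ofReal (ρ ^ l))

lemma geom_ennreal (ρ : ℝ) (h0 : 0 ≤ ρ) (h1 : ρ < 1) :
    ∑' l : ℕ, ENNReal.ofReal (ρ ^ l) = ENNReal.ofReal (1 - ρ)⁻¹ := by
  rw [← ENNReal.ofReal_tsum_of_nonneg (fun n => by positivity) (summable_geometric_of_lt_one h0 h1),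
    tsum_geometric_of_lt_one h0 h1]

/-- A bounded potential excludes small dual vectors. -/
lemma dual_of_Phi (a b η η0 κ1 P Q x G : ℝ) (hP : 0 < P) (hQ : 0 < Q) (hG : 1 ≤ G)
    (hκ1 : 0 < κ1) (hw : ∀ v : ℤ × ℤ × ℤ, isPrim v → 0 < wf a b P Q x v)
    (hPhi : Phi a b η η0 κ1 P Q x ≤ ENNReal.ofReal (1 / √κ1 * G)) :
    ∀ A B C : ℤ, ¬ (A = 0 ∧ B = 0 ∧ C = 0) → |(B : ℝ)| ≤ Q →
      κ1 / G ^ 2 ≤ |A + B * a| / P ∨ κ1 / G ^ 2 ≤ P * Q * |(A + B * a) * x + (C + B * b)| := by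
  classical
  intro A B C hne hB
  obtain ⟨g, v, hg, hv, rfl, rfl, rfl⟩ := exists_prim A B C hne
  have hg1 : (1 : ℝ) ≤ |(g : ℝ)| := by exact_mod_cast Int.one_le_abs hg
  have hwv := hw v hv
  have key : κ1 / G ^ 2 ≤ wf a b P Q x v := by
    by_cases hr : rel a b η0 κ1 P Q x v
    · have h1 : ENNReal.ofReal (phi a b η P Q x v) ≤ ENNReal.ofReal (1 / √κ1 * G) := by
        refine le_trans ?_ hPhi
        have := ENNReal.le_tsum (f := fun v : ℤ × ℤ × ℤ => if rel a b η0 κ1 P Q x v then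
          ENNReal.ofReal (phi a b η P Q x v) else 0) v
        simp only [hr, if_true] at this
        exact this
      have hsk : 0 < √κ1 := Real.sqrt_pos.2 hκ1
      have hsw : 0 < √(wf a b P Q x v) := Real.sqrt_pos.2 hwv
      rw [ENNReal.ofReal_le_ofReal_iff (by positivity)] at h1
      have hh : hf Q v = 1 := by
        unfold hf
        apply max_eq_left
        rw [div_le_one hQ]
        refine le_trans ?_ hB
        push_cast
        rw [abs_mul]
        nlinarith [abs_nonneg (v.2.1 : ℝ)]
      unfold phi at h1
      rw [hh, Real.one_rpow, mul_one, one_div_mul_eq_div, div_le_div_iff₀ hsw hsk, one_mul] at h1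
      rw [div_le_iff₀ (by positivity)]
      have h2 := mul_self_le_mul_self hsk.le h1
      rw [Real.mul_self_sqrt hκ1.le] at h2
      have h3 := Real.mul_self_sqrt hwv.le
      nlinarith
    · unfold rel at hr
      push Not at hr
      have hr := hr hv
      have hh : hf Q v = 1 := by
        unfold hf
        apply max_eq_left
        rw [div_le_one hQ]
        refine le_trans ?_ hB
        push_cast
        rw [abs_mul]
        nlinarith [abs_nonneg (v.2.1 : ℝ)]
      rw [hh, Real.one_rpow, mul_one] at hr
      refine le_trans ?_ hr
      rw [div_le_iff₀ (by positivity)]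
      nlinarith [mul_le_mul hG hG (by norm_num) (by linarith)]
  unfold wf at key
  have e1 : ((g * v.1 : ℤ) : ℝ) + ((g * v.2.1 : ℤ) : ℝ) * a = g * (v.1 + v.2.1 * a) := by
    push_cast; ring
  have e2 : ((g * v.1 : ℤ) + (g * v.2.1 : ℤ) * a : ℝ) * x + ((g * v.2.2 : ℤ) + (g * v.2.1 : ℤ) * b)
      = g * ((v.1 + v.2.1 * a) * x + (v.2.2 + v.2.1 * b)) := by
    push_cast; ring
  rw [e2, e1, abs_mul, abs_mul]
  rcases le_max_iff.1 key with h | h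
  · left
    refine h.trans ?_
    gcongr
    nlinarith [abs_nonneg (v.1 + v.2.1 * a)]
  · right
    refine h.trans ?_
    gcongr
    nlinarith [abs_nonneg ((v.1 + v.2.1 * a) * x + (v.2.2 + v.2.1 * b))]

/-- The node predicate of the Cantor construction. -/
def nodeOK (a b θ1 θ2 η η0 κ κ1 κ2 G S P Q x : ℝ) : Prop :=
  primOK a b κ P Q x ∧ Phi a b η η0 κ1 P Q x ≤ ENNReal.ofReal (1 / √κ1 * G) ∧
    inhOK a b θ1 θ2 κ2 P Q S x

lemma level_step (a b θ1 θ2 η η0 κ κ1 κ2 G P Q s1 s2 x : ℝ) (m : ℕ) (hm : 0 < m)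
    (hP : 0 < P) (hQ : 0 < Q) (hs1 : 2 < s1) (hs2 : 1 ≤ s2)
    (hNS : ((4 * m : ℕ) : ℝ) = s1 * (s1 * s2))
    (hη0 : 1 ≤ η0) (hη : η0 < η) (hsη : s2 ^ η0 ≤ s1 * s2)
    (hG : G = (1 - (2 ^ (-((η - η0) / 2)) : ℝ))⁻¹)
    (hκ0 : 0 < κ) (hκ10 : 0 < κ1) (hκ20 : 0 < κ2)
    (hκ : 8 * (s1 * s2) ^ 2 * κ1 < κ) (hκ' : κ ≤ 1)
    (hc1 : 4 * κ ^ 2 * (s1 * s2) ^ 2 ≤ 1) (hc2 : 4 * κ ^ 2 * (s1 * s2) < κ1 / G ^ 2)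
    (hc3 : 6 * κ2 * (s1 * s2) ≤ κ)
    (hctr : 16 * s2 ^ (η / 2) / √(s1 * s2) ≤ 1 / 16)
    (hcount : 2 * (4 * (s1 * s2) + 1) ≤ (m : ℝ) / 2)
    (hw : ∀ v : ℤ × ℤ × ℤ, isPrim v → 0 < wf a b P Q x v)
    (hx : nodeOK a b θ1 θ2 η η0 κ κ1 κ2 G (s1 * s2) P Q x) :
    {k : ℕ | k < 4 * m ∧ ¬ nodeOK a b θ1 θ2 η η0 κ κ1 κ2 G (s1 * s2) (P * s1) (Q * s2)
      (x + (k : ℝ) / (P ^ 2 * Q * ((4 * m : ℕ) : ℝ)))}.ncard ≤ m := by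
  classical
  obtain ⟨hprim, hPhi, -⟩ := hx
  set N : ℕ := 4 * m with hN
  have hN0 : 0 < N := by omega
  have hNp : (0 : ℝ) < N := by exact_mod_cast hN0
  set ρ : ℝ := 2 ^ (-((η - η0) / 2)) with hρ
  have hρ0 : 0 < ρ := by positivity
  have hρ1 : ρ < 1 := Real.rpow_lt_one_of_one_lt_of_neg (by norm_num) (by linarith)
  have hG1 : 1 ≤ G := by
    rw [hG]; exact (one_le_inv₀ (by linarith)).2 (by linarith)
  set y : ℕ → ℝ := fun k => x + (k : ℝ) / (P ^ 2 * Q * (N : ℝ)) with hy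
  have hyx : ∀ k < N, |x - y k| ≤ 1 / (P ^ 2 * Q) := by
    intro k hk
    have hkN : (k : ℝ) ≤ N := by exact_mod_cast hk.le
    have : x - y k = -((k : ℝ) / (P ^ 2 * Q * (N : ℝ))) := by simp [hy]
    rw [this, abs_neg, abs_of_nonneg (by positivity), div_le_div_iff₀ (by positivity) (by positivity)]
    have : 0 < P ^ 2 * Q := by positivity
    nlinarith
  have hkl : ∀ k l : ℕ, |y k - y l| ≤ 4 / (s1 * (P ^ 2 * Q)) → |(k : ℝ) - l| ≤ 4 * (s1 * s2) := by
    intro k l h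
    have e : y k - y l = ((k : ℝ) - l) / (P ^ 2 * Q * N) := by
      simp only [hy]; ring
    rw [e, abs_div, abs_of_pos (by positivity : 0 < P ^ 2 * Q * (N : ℝ)),
      div_le_div_iff₀ (by positivity) (by positivity), hNS] at h
    have hp : 0 < P ^ 2 * Q * s1 := by positivity
    refine le_of_mul_le_mul_right ?_ hp
    linarith
  set T1 : Set ℕ := {k | k < N ∧ ¬ primOK a b κ (P * s1) (Q * s2) (y k)} with hT1
  set T2 : Set ℕ := {k | k < N ∧ ¬ inhOK a b θ1 θ2 κ2 (P * s1) (Q * s2) (s1 * s2) (y k)} with hT2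
  set T3 : Finset ℕ := (Finset.range N).filter (fun k =>
    ENNReal.ofReal (1 / √κ1 * G) < Phi a b η η0 κ1 (P * s1) (Q * s2) (y k)) with hT3
  have hSS : 0 < s1 * s2 := by positivity
  have c1 : (T1.ncard : ℝ) ≤ 4 * (s1 * s2) + 1 := by
    have := ncard_le_of_close N T1 (fun k hk => hk.1) (4 * (s1 * s2)) (fun k hk l hl =>
      hkl k l (prim_step a b κ (κ1 / G ^ 2) P Q s1 s2 x (y k) (y l) hP hQ hs1 hs2 hκ0 hc1 hc2
        (dual_of_Phi a b η η0 κ1 P Q x G hP hQ hG1 hκ10 hw hPhi) hprim (hyx k hk.1) (hyx l hl.1)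
        hk.2 hl.2))
    rwa [abs_of_pos (by positivity)] at this
  have c2 : (T2.ncard : ℝ) ≤ 4 * (s1 * s2) + 1 := by
    have := ncard_le_of_close N T2 (fun k hk => hk.1) (4 * (s1 * s2)) (fun k hk l hl =>
      hkl k l (inh_step a b θ1 θ2 κ κ2 P Q s1 s2 x (y k) (y l) hP hQ hs1 hs2 hκ20 hc3
        hprim (hyx k hk.1) (hyx l hl.1) hk.2 hl.2))
    rwa [abs_of_pos (by positivity)] at this
  have hMr : 0 < 1 / √κ1 * G := by
    have := Real.sqrt_pos.2 hκ10
    positivity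
  have c3 : (T3.card : ℝ) ≤ (m : ℝ) / 2 := by
    have h1 := dual_step a b η η0 κ κ1 P Q s1 s2 x N (ENNReal.ofReal (1 / √κ1 * G)) hN0 hP hQ
      (by linarith) hs2 hNS hη0 hη hsη hκ10 hκ hκ' hw hprim (by
        rw [← hρ, geom_ennreal ρ hρ0.le hρ1, ← hG, ← ENNReal.ofReal_mul (by positivity)]) hPhi
    have h2 : (T3.card : ENNReal) * ENNReal.ofReal (1 / √κ1 * G) ≤
        ∑ k ∈ Finset.range N, Phi a b η η0 κ1 (P * s1) (Q * s2) (y k) := by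
      calc (T3.card : ENNReal) * ENNReal.ofReal (1 / √κ1 * G)
          = ∑ k ∈ T3, ENNReal.ofReal (1 / √κ1 * G) := by simp
        _ ≤ ∑ k ∈ T3, Phi a b η η0 κ1 (P * s1) (Q * s2) (y k) :=
            Finset.sum_le_sum fun k hk => (Finset.mem_filter.1 hk).2.le
        _ ≤ _ := Finset.sum_le_sum_of_subset (Finset.filter_subset _ _)
    have h3 := h2.trans h1
    rw [← ENNReal.ofReal_natCast, ← ENNReal.ofReal_mul (by positivity),
      show (2 : ENNReal) = ENNReal.ofReal 2 by simp, ← ENNReal.ofReal_mul (by positivity),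
      ← ENNReal.ofReal_mul (by positivity), ENNReal.ofReal_le_ofReal_iff (by positivity)] at h3
    have h4 : (T3.card : ℝ) ≤ N * (16 * s2 ^ (η / 2) / √(s1 * s2)) * 2 := by
      refine le_of_mul_le_mul_right ?_ hMr
      linarith
    have h5 : (N : ℝ) * (16 * s2 ^ (η / 2) / √(s1 * s2)) ≤ N * (1 / 16) := by gcongr
    have h6 : (N : ℝ) = 4 * m := by rw [hN]; push_cast; ring
    linarith
  have hfin1 : T1.Finite := (Set.finite_lt_nat N).subset fun k hk => hk.1
  have hfin2 : T2.Finite := (Set.finite_lt_nat N).subset fun k hk => hk.1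
  have hsub : {k : ℕ | k < N ∧ ¬ nodeOK a b θ1 θ2 η η0 κ κ1 κ2 G (s1 * s2) (P * s1) (Q * s2)
      (y k)} ⊆ T1 ∪ T2 ∪ (T3 : Set ℕ) := by
    intro k hk
    obtain ⟨hkN, hk2⟩ := hk
    by_contra hcon
    simp only [mem_union, not_or] at hcon
    obtain ⟨⟨h1, h2⟩, h3⟩ := hcon
    apply hk2
    refine ⟨?_, ?_, ?_⟩
    · by_contra h; exact h1 ⟨hkN, h⟩
    · by_contra h; apply h3
      simp only [hT3, Finset.coe_filter, Finset.mem_range, mem_ofPred_eq]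
      exact ⟨hkN, not_le.1 h⟩
    · by_contra h; exact h2 ⟨hkN, h⟩
  have hc := Set.ncard_le_ncard hsub ((hfin1.union hfin2).union (Finset.finite_toSet T3))
  have hc' := hc.trans ((Set.ncard_union_le _ _).trans
    (Nat.add_le_add_right (Set.ncard_union_le _ _) _))
  rw [Set.ncard_coe_finset] at hc'
  have : ((T1.ncard + T2.ncard + T3.card : ℕ) : ℝ) ≤ m := by push_cast; linarith
  exact hc'.trans (by exact_mod_cast this)

lemma le_rpow_of_rpow_inv_le (d t i : ℝ) (hd : 0 ≤ d) (hi : 0 < i) (h : d ^ (1 / i) ≤ t) :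
    d ≤ t ^ i := by
  have := Real.rpow_le_rpow (by positivity) h hi.le
  rwa [← Real.rpow_mul hd, one_div_mul_cancel hi.ne', Real.rpow_one] at this

lemma bad_of_nodes (i j : ℝ) (θ : ℝ × ℝ) (a b κ2 S y : ℝ) (hj : 0 < j) (hji : j ≤ i)
    (hij : i + j = 1) (hS : 1 < S) (hκ : 0 < κ2) (hκ1 : κ2 ≤ 1)
    (hnode : ∀ n : ℕ, ∃ x, inhOK a b θ.1 θ.2 κ2 ((S ^ i) ^ n) ((S ^ j) ^ n) S x ∧
      |x - y| ≤ 1 / (((S ^ i) ^ n) ^ 2 * (S ^ j) ^ n)) :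
    (y, a * y + b) ∈ badPair i j θ := by
  have hi : 0 < i := by linarith
  have hS0 : 0 < S := by linarith
  have ha : 0 < 1 + |a| := by positivity
  set t : ℝ := κ2 / (2 * (1 + |a|)) with ht
  have ht0 : 0 < t := by positivity
  set c' : ℝ := min 1 (t ^ (1 / j)) with hc'
  have hc0 : 0 < c' := lt_min one_pos (by positivity)
  have hc1 : c' ≤ 1 := min_le_left _ _
  have hcj : c' ^ j ≤ t := by
    have := Real.rpow_le_rpow hc0.le (min_le_right 1 (t ^ (1 / j))) hj.le
    rwa [← Real.rpow_mul ht0.le, one_div_mul_cancel hj.ne', Real.rpow_one] at this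
  have hcij : c' ^ i ≤ c' ^ j := Real.rpow_le_rpow_of_exponent_ge hc0 hc1 hji
  have ht2 : (1 + |a|) * t = κ2 / 2 := by rw [ht]; field_simp
  have ht3 : t ≤ κ2 / 2 := by nlinarith [abs_nonneg a, mul_nonneg (abs_nonneg a) ht0.le]
  refine ⟨c' * κ2 / S, by positivity, fun q hq => ?_⟩
  by_contra hcon
  push Not at hcon
  have hq1 : (1 : ℝ) ≤ q := by exact_mod_cast hq
  have hex : ∃ n : ℕ, (q : ℝ) < κ2 * S ^ n := by
    obtain ⟨n, hn⟩ := pow_unbounded_of_one_lt (q / κ2) hS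
    exact ⟨n, by rwa [div_lt_iff₀ hκ, mul_comm] at hn⟩
  classical
  obtain ⟨n, hn, hmin⟩ : ∃ n : ℕ, (q : ℝ) < κ2 * S ^ n ∧ ∀ k < n, ¬ (q : ℝ) < κ2 * S ^ k :=
    ⟨Nat.find hex, Nat.find_spec hex, fun k hk => Nat.find_min hex hk⟩
  have hn0 : n ≠ 0 := by
    rintro rfl
    simp at hn; linarith
  obtain ⟨k, rfl⟩ := Nat.exists_eq_succ_of_ne_zero hn0
  have hk : κ2 * S ^ k ≤ q := not_lt.1 (hmin k (by omega))
  set P : ℝ := (S ^ i) ^ (k + 1) with hP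
  set Q : ℝ := (S ^ j) ^ (k + 1) with hQ
  have hPQ : P * Q = S ^ (k + 1) := by
    rw [hP, hQ, ← mul_pow, ← Real.rpow_add hS0, hij, Real.rpow_one]
  have hP0 : 0 < P := by positivity
  have hQ0 : 0 < Q := by positivity
  have hQP : Q ≤ P := by
    apply pow_le_pow_left₀ (by positivity)
    exact Real.rpow_le_rpow_of_exponent_le hS.le hji
  have hcq : c' * κ2 / S / q ≤ c' / S ^ (k + 1) := by
    rw [div_div, div_le_div_iff₀ (by positivity) (by positivity), pow_succ]
    have := mul_le_mul_of_nonneg_left hk (by positivity : 0 ≤ c' * S)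
    linarith
  have hcon := hcon.trans hcq
  have hPi : (S ^ (k + 1)) ^ i = P := by
    rw [hP, ← Real.rpow_natCast, ← Real.rpow_natCast, ← Real.rpow_mul hS0.le,
      ← Real.rpow_mul hS0.le, mul_comm]
  have hQj : (S ^ (k + 1)) ^ j = Q := by
    rw [hQ, ← Real.rpow_natCast, ← Real.rpow_natCast, ← Real.rpow_mul hS0.le,
      ← Real.rpow_mul hS0.le, mul_comm]
  have d1 := le_rpow_of_rpow_inv_le _ _ i (abs_nonneg _) hi ((le_max_left _ _).trans hcon)
  have d2 := le_rpow_of_rpow_inv_le _ _ j (abs_nonneg _) hj ((le_max_right _ _).trans hcon)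
  rw [Real.div_rpow hc0.le (by positivity), hPi] at d1
  rw [Real.div_rpow hc0.le (by positivity), hQj] at d2
  simp only at d1 d2
  set p : ℤ := round ((q : ℝ) * y - θ.1) with hp
  set r : ℤ := round ((q : ℝ) * (a * y + b) - θ.2) with hr
  rw [le_div_iff₀ hP0] at d1
  rw [le_div_iff₀ hQ0] at d2
  obtain ⟨x, hx, hxy⟩ := hnode (k + 1)
  rw [← hP, ← hQ] at hx hxy
  have hq2 : κ2 * (P * Q) / S ≤ ((q : ℤ) : ℝ) := by
    rw [hPQ, pow_succ, div_le_iff₀ hS0]; push_cast; nlinarith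
  have hq3 : ((q : ℤ) : ℝ) < κ2 * (P * Q) := by
    rw [hPQ]; push_cast; exact hn
  have := hx p (q : ℤ) r hq2 hq3
  push_cast at this hq3
  rcases this with h | h
  · have e : (q : ℝ) * x - p - θ.1 = (q * y - θ.1 - p) + q * (x - y) := by ring
    have e2 : |(q : ℝ) * x - p - θ.1| ≤ |q * y - θ.1 - p| + q * (1 / (P ^ 2 * Q)) := by
      rw [e]
      refine (abs_add_le _ _).trans ?_
      rw [abs_mul, abs_of_nonneg (by positivity : (0 : ℝ) ≤ q)]
      gcongr
    have e3 : P * (q * (1 / (P ^ 2 * Q))) < κ2 := by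
      have : P * (q * (1 / (P ^ 2 * Q))) = q / (P * Q) := by field_simp
      rw [this, div_lt_iff₀ (by positivity)]; exact hq3
    have e4 := mul_le_mul_of_nonneg_left e2 hP0.le
    rw [mul_add] at e4
    have e6 : P * |q * y - θ.1 - p| ≤ t := by rw [mul_comm]; exact d1.trans (hcij.trans hcj)
    linarith
  · have e : a * p + b * q - r + (a * θ.1 - θ.2) =
        (q * (a * y + b) - θ.2 - r) - a * (q * y - θ.1 - p) := by ring
    have e2 : |a * p + b * q - r + (a * θ.1 - θ.2)| ≤
        |q * (a * y + b) - θ.2 - r| + |a| * |q * y - θ.1 - p| := by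
      rw [e, ← abs_mul]
      exact abs_sub _ _
    have e4 := mul_le_mul_of_nonneg_left e2 hQ0.le
    have e5 : Q * (|a| * |q * y - θ.1 - p|) ≤ |a| * t := by
      calc Q * (|a| * |q * y - θ.1 - p|) ≤ P * (|a| * |q * y - θ.1 - p|) := by gcongr
        _ = |a| * (|q * y - θ.1 - p| * P) := by ring
        _ ≤ |a| * t := by gcongr; linarith
    rw [mul_add] at e4
    have e6 : Q * |q * (a * y + b) - θ.2 - r| ≤ t := by rw [mul_comm]; exact d2.trans hcj
    linarith

/-- The Diophantine condition in dual form. -/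
def dualDio (a b η0 c0 : ℝ) : Prop := ∀ A B C : ℤ, ¬ (A = 0 ∧ B = 0 ∧ C = 0) →
  c0 * (max 1 |(B : ℝ)|) ^ (-η0) ≤ max |A + B * a| |C + B * b|

lemma wf_pos (a b η0 c0 : ℝ) (hc0 : 0 < c0) (hD : dualDio a b η0 c0) (P Q x : ℝ) (hP : 0 < P)
    (hQ : 0 < Q) (v : ℤ × ℤ × ℤ) (hv : isPrim v) : 0 < wf a b P Q x v := by
  have h := hD v.1 v.2.1 v.2.2 (isPrim_ne hv)
  have h1 : 0 < max |v.1 + v.2.1 * a| |v.2.2 + v.2.1 * b| := by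
    refine lt_of_lt_of_le ?_ h
    have : (0 : ℝ) < max 1 |(v.2.1 : ℝ)| := lt_of_lt_of_le one_pos (le_max_left _ _)
    positivity
  unfold wf
  by_cases hA : (v.1 : ℝ) + v.2.1 * a = 0
  · rw [hA] at h1 ⊢
    refine lt_of_lt_of_le ?_ (le_max_right _ _)
    simp only [abs_zero, zero_mul, zero_add] at h1 ⊢
    have : 0 < |(v.2.2 : ℝ) + v.2.1 * b| := by
      rcases lt_max_iff.1 h1 with h | h
      · exact absurd h (lt_irrefl _)
      · exact h
    positivity
  · refine lt_of_lt_of_le ?_ (le_max_left _ _)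
    have := abs_pos.2 hA
    positivity

lemma node_init (a b θ1 θ2 η η0 κ κ1 κ2 G S c0 : ℝ) (hS : 1 ≤ S) (hD : dualDio a b η0 c0)
    (hκ : κ ≤ 1) (hκ1 : κ1 ≤ c0) (hκ2 : κ2 ≤ 1) (hκ20 : 0 < κ2) :
    nodeOK a b θ1 θ2 η η0 κ κ1 κ2 G S 1 1 0 := by
  refine ⟨?_, ?_, ?_⟩
  · intro p q r hne
    have key : ∀ z : ℤ, z ≠ 0 → κ ≤ |(z : ℝ)| := fun z hz =>
      hκ.trans (by exact_mod_cast Int.one_le_abs hz)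
    by_cases hq : q = 0
    · by_cases hp : p = 0
      · right; right
        subst hq hp
        have hr : r ≠ 0 := by tauto
        simpa using key r hr
      · right; left
        subst hq
        simpa using key p hp
    · left; simpa using key q hq
  · have : Phi a b η η0 κ1 1 1 0 = 0 := by
      unfold Phi
      rw [ENNReal.tsum_eq_zero]
      intro v
      rw [if_neg]
      rintro ⟨hv, hlt⟩
      have h := hD v.1 v.2.1 v.2.2 (isPrim_ne hv)
      have hp : (0 : ℝ) < max 1 |(v.2.1 : ℝ)| := lt_of_lt_of_le one_pos (le_max_left _ _)
      rw [Real.rpow_neg hp.le, ← div_eq_mul_inv, div_le_iff₀ (by positivity)] at h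
      unfold wf hf at hlt
      simp only [div_one, mul_one, one_mul, mul_zero, zero_add] at hlt
      linarith
    rw [this]; exact zero_le
  · intro p q r h1 h2
    exfalso
    rw [mul_one, mul_one] at h1 h2
    have h3 : (0 : ℝ) < q := lt_of_lt_of_le (by positivity) h1
    have h4 : (q : ℝ) < 1 := by linarith
    have h3' : 0 < q := by exact_mod_cast h3
    have h4' : q < 1 := by exact_mod_cast h4
    omega

lemma core_m (i j : ℝ) (θ : ℝ × ℝ) (a b η η0 c0 S : ℝ) (m : ℕ) (hm : 2 ≤ m)
    (hj : 0 < j) (hji : j ≤ i) (hij : i + j = 1) (hc0 : 0 < c0) (hD : dualDio a b η0 c0)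
    (hS : 1 < S) (hNS : ((4 * m : ℕ) : ℝ) = S ^ i * S) (hs1 : 2 < S ^ i)
    (hη0 : 1 ≤ η0) (hη : η0 < η) (hηj : η0 * j ≤ 1)
    (hctr : 16 * (S ^ j) ^ (η / 2) / √S ≤ 1 / 16)
    (hcount : 2 * (4 * S + 1) ≤ (m : ℝ) / 2) :
    ENNReal.ofReal (Real.log m / Real.log ((4 * m : ℕ) : ℝ)) ≤
      dimH {x : ℝ | (x, a * x + b) ∈ badPair i j θ} := by
  have hS0 : 0 < S := by linarith
  have hSS : S ^ i * S ^ j = S := by rw [← Real.rpow_add hS0, hij, Real.rpow_one]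
  set ρ : ℝ := 2 ^ (-((η - η0) / 2)) with hρ
  have hρ0 : 0 < ρ := by positivity
  have hρ1 : ρ < 1 := Real.rpow_lt_one_of_one_lt_of_neg (by norm_num) (by linarith)
  set G : ℝ := (1 - ρ)⁻¹ with hG
  have hG1 : 1 ≤ G := (one_le_inv₀ (by linarith)).2 (by linarith)
  have hG2 : 1 ≤ G ^ 2 := one_le_pow₀ hG1
  have hS3 : S ≤ S ^ 3 := by nlinarith [sq_nonneg S, mul_pos hS0 hS0]
  have hS2 : 1 ≤ S ^ 2 := one_le_pow₀ hS.le
  set K : ℝ := S ^ 3 * G ^ 2 with hK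
  have hKS : S ≤ K := by rw [hK]; nlinarith
  have hK0 : 0 < K := by linarith
  set κ : ℝ := min c0 (1 / (65 * K)) with hκ
  have hκ0 : 0 < κ := lt_min hc0 (by positivity)
  have hκc : κ ≤ c0 := min_le_left _ _
  have hκK : κ * (65 * K) ≤ 1 := by
    have := min_le_right c0 (1 / (65 * K))
    rw [← hκ, le_div_iff₀ (by positivity)] at this
    exact this
  have hκS : κ * S ≤ 1 / 65 := by nlinarith
  have hκ1 : κ ≤ 1 / 65 := by nlinarith
  set κ1 : ℝ := κ / (16 * S ^ 2) with hkapA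
  have hκ10 : 0 < κ1 := by positivity
  have hkapC : κ1 ≤ κ := by
    rw [hkapA]; exact div_le_self hκ0.le (by linarith)
  set κ2 : ℝ := κ / (6 * S) with hkapB
  have hκ20 : 0 < κ2 := by positivity
  have hkapD : κ2 ≤ κ := by
    rw [hkapB]; exact div_le_self hκ0.le (by linarith)
  set Pr : ℕ → ℝ → Prop := fun n x =>
    nodeOK a b θ.1 θ.2 η η0 κ κ1 κ2 G S ((S ^ i) ^ n) ((S ^ j) ^ n) x with hPr
  have hPQ : ∀ n : ℕ, ((S ^ i) ^ n) ^ 2 * (S ^ j) ^ n = ((4 * m : ℕ) : ℝ) ^ n := by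
    intro n
    rw [hNS]
    conv_rhs => rw [← hSS]
    rw [mul_pow, mul_pow, hSS]; ring
  have hmain := cantor_dim m hm Pr 0 (by
      simp only [hPr, pow_zero]
      exact node_init a b θ.1 θ.2 η η0 κ κ1 κ2 G S c0 hS.le hD (by linarith) (by linarith)
        (by linarith) hκ20) (by
      intro n x hx
      have h := level_step a b θ.1 θ.2 η η0 κ κ1 κ2 G ((S ^ i) ^ n) ((S ^ j) ^ n) (S ^ i) (S ^ j) x m
        (by omega) (by positivity) (by positivity) hs1 (Real.one_le_rpow hS.le hj.le)
        (by rw [hSS]; exact hNS) hη0 hη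
        (by
          rw [hSS, ← Real.rpow_mul hS0.le]
          calc S ^ (j * η0) ≤ S ^ (1 : ℝ) :=
                Real.rpow_le_rpow_of_exponent_le hS.le (by linarith)
            _ = S := Real.rpow_one S) hG hκ0 hκ10 hκ20
        (by
          rw [hSS, hkapA]
          have : 8 * S ^ 2 * (κ / (16 * S ^ 2)) = κ / 2 := by field_simp; norm_num
          rw [this]; linarith) (by linarith)
        (by
          rw [hSS]
          have : κ ^ 2 * S ^ 2 = (κ * S) ^ 2 := by ring
          nlinarith [mul_pos hκ0 hS0])
        (by
          rw [hSS, hkapA, div_div, lt_div_iff₀ (by positivity)]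
          have : 4 * κ ^ 2 * S * (16 * S ^ 2 * G ^ 2) = 64 * κ * (κ * K) := by rw [hK]; ring
          rw [this]
          have : κ * K ≤ 1 / 65 := by linarith
          nlinarith)
        (by
          rw [hSS, hkapB]
          apply le_of_eq; field_simp)
        (by rw [hSS]; exact hctr) (by rw [hSS]; exact hcount)
        (wf_pos a b η0 c0 hc0 hD _ _ x (by positivity) (by positivity))
        (by rw [hSS]; exact hx)
      rw [hSS, hPQ n] at h
      simp only [hPr, pow_succ]
      exact h)
  refine hmain.trans (dimH_mono ?_)
  intro y hy
  apply bad_of_nodes i j θ a b κ2 S y hj hji hij hS hκ20 (by linarith)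
  intro n
  obtain ⟨x, hx, h1, h2⟩ := hy n
  refine ⟨x, hx.2.2, ?_⟩
  rw [hPQ n, abs_sub_le_iff]
  constructor <;> linarith [show (0 : ℝ) ≤ 1 / ((4 * m : ℕ) : ℝ) ^ n by positivity]

lemma log_ratio_tendsto : Tendsto (fun m : ℕ => Real.log m / Real.log ((4 * m : ℕ) : ℝ)) atTop
    (nhds 1) := by
  have hl : Tendsto (fun m : ℕ => Real.log (m : ℝ)) atTop atTop :=
    Real.tendsto_log_atTop.comp tendsto_natCast_atTop_atTop
  have h1 : Tendsto (fun m : ℕ => (Real.log 4 / Real.log (m : ℝ) + 1)⁻¹) atTop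
      (nhds ((0 + 1)⁻¹)) := by
    apply Tendsto.inv₀ _ (by norm_num)
    exact (hl.const_div_atTop _).add_const 1
  rw [zero_add, inv_one] at h1
  refine h1.congr' ?_
  filter_upwards [eventually_ge_atTop 2] with m hm
  have hm0 : (0 : ℝ) < m := by positivity
  have hlm : 0 < Real.log (m : ℝ) := Real.log_pos (by exact_mod_cast (by omega : 1 < m))
  have h4 : 0 < Real.log 4 := Real.log_pos (by norm_num)
  push_cast
  rw [Real.log_mul (by norm_num) hm0.ne']
  field_simp

theorem core_dim (i j : ℝ) (θ : ℝ × ℝ) (a b ε c0 : ℝ)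
    (hj : 0 < j) (hji : j ≤ i) (hij : i + j = 1) (hc0 : 0 < c0) (hε : 0 < ε) (hε2 : ε ≤ 1 / 2)
    (hD : dualDio a b (1 / j - ε) c0) :
    1 ≤ dimH {x : ℝ | (x, a * x + b) ∈ badPair i j θ} := by
  have hi : 0 < i := by linarith
  have hj2 : 2 ≤ 1 / j := by rw [le_div_iff₀ hj]; linarith
  set Sf : ℕ → ℝ := fun m => ((4 * m : ℕ) : ℝ) ^ (1 / (1 + i)) with hSf
  have hSt : Tendsto Sf atTop atTop := by
    refine (tendsto_rpow_atTop (by positivity : 0 < 1 / (1 + i))).comp ?_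
    exact tendsto_natCast_atTop_atTop.comp (tendsto_id.const_mul_atTop' (by norm_num : 0 < 4))
  have hSit : Tendsto (fun m => Sf m ^ i) atTop atTop := (tendsto_rpow_atTop hi).comp hSt
  have hSc : Tendsto (fun m => 16 * Sf m ^ (-(j * ε / 4))) atTop (nhds (16 * 0)) :=
    ((tendsto_rpow_neg_atTop (by positivity)).comp hSt).const_mul 16
  rw [mul_zero] at hSc
  have hlim : Tendsto (fun m : ℕ => ENNReal.ofReal (Real.log m / Real.log ((4 * m : ℕ) : ℝ))) atTop
      (nhds 1) := by
    have := ENNReal.tendsto_ofReal log_ratio_tendsto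
    rwa [ENNReal.ofReal_one] at this
  refine le_of_tendsto hlim ?_
  filter_upwards [eventually_ge_atTop 2, hSt.eventually_gt_atTop 1, hSit.eventually_ge_atTop 80,
    hSc.eventually_le_const (by norm_num : (0 : ℝ) < 1 / 16)] with m hm h1 h2 h3
  have hS0 : 0 < Sf m := by linarith
  have hNS : ((4 * m : ℕ) : ℝ) = Sf m ^ i * Sf m := by
    calc ((4 * m : ℕ) : ℝ) = Sf m ^ (1 + i) := by
          rw [hSf]
          simp only
          rw [← Real.rpow_mul (by positivity), one_div_mul_cancel (by positivity), Real.rpow_one]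
      _ = _ := by rw [Real.rpow_add hS0, Real.rpow_one, mul_comm]
  refine core_m i j θ a b (1 / j - ε / 2) (1 / j - ε) c0 (Sf m) m hm hj hji hij hc0 hD h1 hNS
    (by linarith) (by linarith) (by linarith) ?_ ?_ ?_
  · rw [sub_mul, one_div_mul_cancel hj.ne']
    nlinarith
  · refine le_trans (le_of_eq ?_) h3
    rw [Real.sqrt_eq_rpow, ← Real.rpow_mul hS0.le, mul_div_assoc, ← Real.rpow_sub hS0]
    congr 2
    field_simp
    ring
  · push_cast at hNS
    nlinarith

/-- Sharpened form: transfer to the line. -/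
lemma line_dim (i j : ℝ) (θ : ℝ × ℝ) (a b : ℝ)
    (h : 1 ≤ dimH {x : ℝ | (x, a * x + b) ∈ badPair i j θ}) :
    1 ≤ dimH (badPair i j θ ∩ {p : ℝ × ℝ | ∃ x : ℝ, p = (x, a * x + b)}) := by
  refine h.trans ?_
  have hl : LipschitzWith 1 (Prod.fst : ℝ × ℝ → ℝ) := LipschitzWith.prod_fst
  refine le_trans (dimH_mono ?_) (hl.dimH_image_le _)
  intro x hx
  exact ⟨(x, a * x + b), ⟨hx, x, rfl⟩, rfl⟩

lemma line_dim_le (E : Set (ℝ × ℝ)) (a b : ℝ) :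
    dimH (E ∩ {p : ℝ × ℝ | ∃ x : ℝ, p = (x, a * x + b)}) ≤ 1 := by
  have hf : ContDiff ℝ 1 (fun x : ℝ => (x, a * x + b)) := by fun_prop
  have h := hf.dimH_range_le
  rw [Module.finrank_self, Nat.cast_one] at h
  refine le_trans (dimH_mono ?_) h
  rintro p ⟨-, x, rfl⟩
  exact ⟨x, rfl⟩

lemma dist_le_int (t : ℝ) (z : ℤ) : distNearestInt t ≤ |t - z| := round_le t z

lemma dist_nonneg' (t : ℝ) : 0 ≤ distNearestInt t := abs_nonneg _

/-- The Diophantine hypothesis yields the dual form. -/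
lemma dualDio_of_liminf (a b η0 ε : ℝ) (hε : 0 < ε) (σ : ℝ) (hη0 : 0 ≤ η0) (hη : 1 / σ - ε ≤ η0)
    (h : 0 < Filter.atTop.liminf (fun q : ℕ =>
        ENNReal.ofReal ((q : ℝ) ^ (1 / σ - ε) *
          max (distNearestInt ((q : ℝ) * a)) (distNearestInt ((q : ℝ) * b))))) :
    ∃ c0, 0 < c0 ∧ dualDio a b η0 c0 := by
  obtain ⟨c, hc0, hc⟩ := exists_between h
  have hev := eventually_lt_of_lt_liminf hc
  obtain ⟨N0, hN0⟩ := eventually_atTop.1 hev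
  have hctop : c ≠ ⊤ := (hc.trans_le le_top).ne
  have hcr : 0 < c.toReal := ENNReal.toReal_pos hc0.ne' hctop
  set c1 := c.toReal with hc1
  set N : ℕ := max N0 1 with hN
  have hN1 : 1 ≤ N := le_max_right _ _
  have hNr : (1 : ℝ) ≤ N := by exact_mod_cast hN1
  have key : ∀ q : ℕ, N ≤ q → c1 ≤ (q : ℝ) ^ η0 *
      max (distNearestInt ((q : ℝ) * a)) (distNearestInt ((q : ℝ) * b)) := by
    intro q hq
    have hq1 : (1 : ℝ) ≤ q := by exact_mod_cast hN1.trans hq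
    have h0 : 0 ≤ max (distNearestInt ((q : ℝ) * a)) (distNearestInt ((q : ℝ) * b)) :=
      (dist_nonneg' _).trans (le_max_left _ _)
    have h1 := (hN0 q ((le_max_left _ _).trans hq)).le
    have h2 := ENNReal.toReal_mono ENNReal.ofReal_ne_top h1
    rw [ENNReal.toReal_ofReal (by positivity)] at h2
    refine h2.trans ?_
    gcongr
  set c0 : ℝ := min 1 (c1 * (N : ℝ) ^ (-η0) / N) with hc0d
  have hNpos : (0 : ℝ) < N := by linarith
  refine ⟨c0, lt_min one_pos (by positivity), ?_⟩
  intro A B C hne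
  have hp : (0 : ℝ) < max 1 |(B : ℝ)| := lt_of_lt_of_le one_pos (le_max_left _ _)
  by_cases hB : B = 0
  · subst hB
    simp only [Int.cast_zero, abs_zero, zero_mul, add_zero]
    rw [max_eq_left (by norm_num : (0 : ℝ) ≤ 1), Real.one_rpow, mul_one]
    refine (min_le_left _ _).trans ?_
    by_cases hA : A = 0
    · have hC : C ≠ 0 := by tauto
      exact le_max_of_le_right (by exact_mod_cast Int.one_le_abs hC)
    · exact le_max_of_le_left (by exact_mod_cast Int.one_le_abs hA)
  · have hB1 : (1 : ℝ) ≤ |(B : ℝ)| := by exact_mod_cast Int.one_le_abs hB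
    rw [max_eq_right hB1]
    have hBn : 1 ≤ B.natAbs := Int.natAbs_pos.2 hB
    have hk := key (N * B.natAbs) (Nat.le_mul_of_pos_right _ hBn)
    have hcast : ((N * B.natAbs : ℕ) : ℝ) = N * |(B : ℝ)| := by
      rw [Nat.cast_mul, Nat.cast_natAbs, Int.cast_abs]
    rw [hcast] at hk
    have hd : ∀ (t : ℝ) (Z : ℤ), distNearestInt (N * |(B : ℝ)| * t) ≤ N * |(Z : ℝ) + B * t| := by
      intro t Z
      rcases le_or_gt 0 (B : ℝ) with hs | hs
      · have := dist_le_int (N * |(B : ℝ)| * t) (-(N * Z))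
        refine this.trans (le_of_eq ?_)
        have e : (N : ℝ) * |(B : ℝ)| * t - ((-(N * Z) : ℤ) : ℝ) = N * (Z + B * t) := by
          rw [abs_of_nonneg hs]; push_cast; ring
        rw [e, abs_mul, abs_of_pos hNpos]
      · have := dist_le_int (N * |(B : ℝ)| * t) (N * Z)
        refine this.trans (le_of_eq ?_)
        have e : (N : ℝ) * |(B : ℝ)| * t - ((N * Z : ℤ) : ℝ) = -(N * (Z + B * t)) := by
          rw [abs_of_neg hs]; push_cast; ring
        rw [e, abs_neg, abs_mul, abs_of_pos hNpos]
    have hmax : max (distNearestInt (N * |(B : ℝ)| * a)) (distNearestInt (N * |(B : ℝ)| * b)) ≤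
        N * max |A + B * a| |C + B * b| := by
      rw [mul_max_of_nonneg _ _ hNpos.le]
      exact max_le_max (hd a A) (hd b C)
    have hBp : 0 < |(B : ℝ)| := by linarith
    have h5 : c1 ≤ (N * |(B : ℝ)|) ^ η0 * (N * max |A + B * a| |C + B * b|) :=
      hk.trans (by gcongr)
    rw [Real.mul_rpow hNpos.le hBp.le] at h5
    have hNe : 0 < (N : ℝ) ^ η0 := by positivity
    have hBe : 0 < |(B : ℝ)| ^ η0 := by positivity
    calc c0 * |(B : ℝ)| ^ (-η0) ≤ (c1 * (N : ℝ) ^ (-η0) / N) * |(B : ℝ)| ^ (-η0) := by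
          gcongr; exact min_le_right _ _
      _ = c1 / ((N : ℝ) ^ η0 * |(B : ℝ)| ^ η0 * N) := by
          rw [Real.rpow_neg hNpos.le, Real.rpow_neg hBp.le]; field_simp
      _ ≤ _ := by
          rw [div_le_iff₀ (by positivity)]
          linarith

/-- The swapped line satisfies the same condition. -/
lemma dualDio_swap (a b η0 c0 : ℝ) (ha : a ≠ 0) (hη0 : 0 ≤ η0) (hc0 : 0 < c0)
    (h : dualDio a b η0 c0) : ∃ c1, 0 < c1 ∧ dualDio (1 / a) (-b / a) η0 c1 := by
  have haa : 0 < |a| := abs_pos.2 ha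
  -- the maximum of the two old forms is at most `K` times the new one
  set K : ℝ := 1 + |a| + |b| with hK
  have hK0 : 0 < K := by positivity
  set R : ℝ := max 1 (2 * (1 + |a|) / |a|) with hR
  have hR1 : 1 ≤ R := le_max_left _ _
  have hR0 : 0 < R := by linarith
  refine ⟨min 1 (c0 * R ^ (-η0) / K), lt_min one_pos (by positivity), ?_⟩
  intro B A C hne
  have hmp : (1 : ℝ) ≤ max 1 |(A : ℝ)| := le_max_left _ _
  have hm0 : (0 : ℝ) < max 1 |(A : ℝ)| := by linarith
  set X : ℝ := B + A * (1 / a) with hX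
  set Y : ℝ := C + A * (-b / a) with hY
  have e1 : (A : ℝ) + B * a = a * X := by rw [hX]; field_simp; ring
  have e2 : (C : ℝ) + B * b = Y + b * X := by rw [hX, hY]; field_simp; ring
  by_cases hXl : 1 ≤ |X|
  · refine le_trans ?_ (hXl.trans (le_max_left _ _))
    have h1 : (max 1 |(A : ℝ)|) ^ (-η0) ≤ 1 :=
      Real.rpow_le_one_of_one_le_of_nonpos hmp (by linarith)
    have h2 : min 1 (c0 * R ^ (-η0) / K) ≤ 1 := min_le_left _ _
    have h3 : 0 ≤ min 1 (c0 * R ^ (-η0) / K) := le_min one_pos.le (by positivity)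
    have h4 : 0 ≤ (max 1 |(A : ℝ)|) ^ (-η0) := by positivity
    nlinarith
  · push Not at hXl
    have hd := h A B C (by tauto)
    have hB : max 1 |(B : ℝ)| ≤ R * max 1 |(A : ℝ)| := by
      apply max_le
      · nlinarith
      · have e3 : (B : ℝ) = X - A * (1 / a) := by rw [hX]; ring
        have e4 : |(B : ℝ)| ≤ 1 + |(A : ℝ)| / |a| := by
          rw [e3]
          refine (abs_sub _ _).trans ?_
          rw [abs_mul, abs_div, abs_one, mul_one_div]
          linarith
        refine e4.trans ?_
        have e5 : 1 + |(A : ℝ)| / |a| ≤ (1 + 1 / |a|) * max 1 |(A : ℝ)| := by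
          have h6 : |(A : ℝ)| / |a| ≤ 1 / |a| * max 1 |(A : ℝ)| := by
            rw [one_div_mul_eq_div]
            gcongr
            exact le_max_right _ _
          linarith
        refine e5.trans ?_
        gcongr
        refine le_trans ?_ (le_max_right _ _)
        rw [le_div_iff₀ haa]
        have : (1 + 1 / |a|) * |a| = |a| + 1 := by field_simp
        rw [this]; linarith
    have h7 : (R * max 1 |(A : ℝ)|) ^ (-η0) ≤ (max 1 |(B : ℝ)|) ^ (-η0) :=
      Real.rpow_le_rpow_of_nonpos (lt_of_lt_of_le one_pos (le_max_left _ _)) hB (by linarith)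
    rw [Real.mul_rpow hR0.le hm0.le] at h7
    have h8 : max |A + B * a| |C + B * b| ≤ K * max |X| |Y| := by
      have hx := le_max_left |X| |Y|
      have hy := le_max_right |X| |Y|
      have hz : 0 ≤ max |X| |Y| := (abs_nonneg _).trans hx
      rw [e1, e2]
      apply max_le
      · rw [abs_mul]
        nlinarith [abs_nonneg b, mul_le_mul_of_nonneg_left hx haa.le, mul_nonneg (abs_nonneg b) hz]
      · refine (abs_add_le _ _).trans ?_
        rw [abs_mul]
        nlinarith [abs_nonneg b, mul_le_mul_of_nonneg_left hx (abs_nonneg b), mul_nonneg haa.le hz]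
    calc min 1 (c0 * R ^ (-η0) / K) * (max 1 |(A : ℝ)|) ^ (-η0)
        ≤ (c0 * R ^ (-η0) / K) * (max 1 |(A : ℝ)|) ^ (-η0) := by
          gcongr; exact min_le_right _ _
      _ = c0 * (R ^ (-η0) * (max 1 |(A : ℝ)|) ^ (-η0)) / K := by ring
      _ ≤ c0 * (max 1 |(B : ℝ)|) ^ (-η0) / K := by gcongr
      _ ≤ max |X| |Y| := by
          rw [div_le_iff₀ hK0]; linarith

lemma bad_swap (i j : ℝ) (θ : ℝ × ℝ) (p : ℝ × ℝ) :
    p ∈ badPair j i θ.swap ↔ p.swap ∈ badPair i j θ := by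
  unfold badPair
  simp only [Set.mem_ofPred_eq, Prod.fst_swap, Prod.snd_swap]
  refine exists_congr fun c => and_congr_right fun _ => forall_congr' fun q => ?_
  rw [max_comm]

theorem stmt2 (i j : ℝ) (θ : ℝ × ℝ) (a b : ℝ)
    (hi0 : 0 < i) (hi1 : i < 1) (hj0 : 0 < j) (hj1 : j < 1) (hij : i + j = 1)
    (ha : a ≠ 0)
    (hdio : ∃ ε : ℝ, 0 < ε ∧
      0 < Filter.atTop.liminf (fun q : ℕ =>
        ENNReal.ofReal ((q : ℝ) ^ (1 / min i j - ε) *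
          max (distNearestInt ((q : ℝ) * a)) (distNearestInt ((q : ℝ) * b))))) :
    dimH (badPair i j θ ∩ {p : ℝ × ℝ | ∃ x : ℝ, p = (x, a * x + b)}) = 1 := by
  obtain ⟨ε, hε, h⟩ := hdio
  refine le_antisymm (line_dim_le _ a b) ?_
  have hε'0 : 0 < min ε (1 / 2) := lt_min hε (by norm_num)
  have hε'2 : min ε (1 / 2) ≤ 1 / 2 := min_le_right _ _
  have hε' : min ε (1 / 2) ≤ ε := min_le_left _ _
  have hσ0 : 0 < min i j := lt_min hi0 hj0
  have hσ : 2 ≤ 1 / min i j := by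
    rw [le_div_iff₀ hσ0]
    linarith [min_le_left i j, min_le_right i j]
  obtain ⟨c0, hc0, hD⟩ := dualDio_of_liminf a b (1 / min i j - min ε (1 / 2)) ε hε (min i j)
    (by linarith) (by linarith) h
  rcases le_total j i with hji | hji
  · rw [min_eq_right hji] at hD
    exact line_dim i j θ a b (core_dim i j θ a b _ c0 hj0 hji hij hc0 hε'0 hε'2 hD)
  · obtain ⟨c1, hc1, hD1⟩ := dualDio_swap a b _ c0 ha (by linarith) hc0 hD
    rw [min_eq_left hji] at hD1
    have h1 := line_dim j i θ.swap (1 / a) (-b / a)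
      (core_dim j i θ.swap (1 / a) (-b / a) _ c1 hi0 hji (by linarith) hc1 hε'0 hε'2 hD1)
    refine h1.trans ?_
    have hl : LipschitzWith 1 (Prod.swap : ℝ × ℝ → ℝ × ℝ) := by
      have := (LipschitzWith.prod_snd (α := ℝ) (β := ℝ)).prodMk
        (LipschitzWith.prod_fst (α := ℝ) (β := ℝ))
      rw [max_self] at this
      exact this
    refine le_trans (dimH_mono ?_) (hl.dimH_image_le _)
    rintro p ⟨hp, y, rfl⟩
    refine ⟨(1 / a * y + -b / a, y), ⟨?_, 1 / a * y + -b / a, ?_⟩, rfl⟩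
    · exact (bad_swap i j θ _).1 hp
    · congr 1
      field_simp
      ring
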